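/- For Lebesgue-a.e. x ∈ [0,1], the digits d_j(x) of the backward continued fraction expansion of x satisfy: ( ∑_{j=1}^{N+m(N,E,x)} d_j(x) − max{ 2·m(N,E,x), max_{1≤k≤N+m(N,E,x)} d_k(x) } ) / N → 3 as N → ∞, where E = [1/2,1] and m(N,E,x) is the longest excursion of the T_BCF-orbit of x out of E beginning in the first N steps. -/

import Mathlib

open MeasureTheory Filter Set Asymptotics

noncomputable section

namespace InfErg

variable {X : Type*} [MeasurableSpace X]

/-- The first return time `φ_E(x) = min {k ≥ 1 : T^k x ∈ E}`. -/
def returnTime (T : X → X) (E : Set X) (x : X) : ℕ :=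
  sInf {k : ℕ | 1 ≤ k ∧ T^[k] x ∈ E}

/-- The hitting time `h_E(x) = min {k ≥ 0 : T^k x ∈ E}`. -/
def hitTime (T : X → X) (E : Set X) (x : X) : ℕ :=
  sInf {k : ℕ | T^[k] x ∈ E}

/-- The level set `A_n = {x ∈ E : φ_E(x) = n}`. -/
def levelSet (T : X → X) (E : Set X) (n : ℕ) : Set X :=
  {x | x ∈ E ∧ returnTime T E x = n}

/-- The super-level set `A_{>n} = {x ∈ E : φ_E(x) > n}`. -/
def superLevelSet (T : X → X) (E : Set X) (n : ℕ) : Set X :=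
  {x | x ∈ E ∧ n < returnTime T E x}

/-- The wandering rate `w_n(E) = ∑_{k=0}^{n-1} μ(A_{>k})`. -/
def wanderingRate (T : X → X) (E : Set X) (μ : Measure X) (n : ℕ) : ℝ :=
  ∑ k ∈ Finset.range n, (μ (superLevelSet T E k)).toReal

/-- `α(n) = n / w_n(E)`. -/
def alphaSeq (T : X → X) (E : Set X) (μ : Measure X) (n : ℕ) : ℝ :=
  (n : ℝ) / wanderingRate T E μ n

/-- The induced map `T_E(x) = T^{φ_E(x)}(x)`. -/
def inducedMap (T : X → X) (E : Set X) (x : X) : X :=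
  T^[returnTime T E x] x

/-- The Birkhoff sum `S_N g(x) = ∑_{n=1}^N g(T^{n-1} x)`. -/
def birkhoffSum (T : X → X) (g : X → ℝ) (N : ℕ) (x : X) : ℝ :=
  ∑ i ∈ Finset.range N, g (T^[i] x)

/-- `max_{1 ≤ k ≤ N} g(T^{k-1} x)`. -/
def birkhoffMax (T : X → X) (g : X → ℝ) (N : ℕ) (x : X) : ℝ :=
  sSup ((fun i => g (T^[i] x)) '' {i : ℕ | i < N})

/-- The trimmed Birkhoff sum `S^r_N g(x)`: the Birkhoff sum with the `r` largest
summands among `g(x), g(Tx), …, g(T^{N-1}x)` removed; equivalently, the smallest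
possible sum of `N - r` of these summands. -/
def trimmedBirkhoffSum (T : X → X) (g : X → ℝ) (r N : ℕ) (x : X) : ℝ :=
  sInf {s : ℝ | ∃ A : Finset ℕ, A ⊆ Finset.range N ∧ A.card = N - r ∧
    s = ∑ i ∈ A, g (T^[i] x)}

/-- The trimmed sum `S_N^r(ω)` of a sequence of random variables: the sum of
`Y_1(ω), …, Y_N(ω)` with the `r` largest entries removed; equivalently, the
smallest possible sum of `N - r` of these entries. -/
def trimmedSumSeq {Ω : Type*} (Y : ℕ → Ω → ℝ) (r N : ℕ) (ω : Ω) : ℝ :=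
  sInf {s : ℝ | ∃ A : Finset ℕ, A ⊆ Finset.range N ∧ A.card = N - r ∧
    s = ∑ i ∈ A, Y i ω}

/-- The `r`-th maximum `M^r_N(ω)` among `Y_1(ω), …, Y_N(ω)`. -/
def rthMaxSeq {Ω : Type*} (Y : ℕ → Ω → ℝ) (r N : ℕ) (ω : Ω) : ℝ :=
  sSup {m : ℝ | ∃ A : Finset ℕ, A ⊆ Finset.range N ∧ A.card = r ∧ ∀ i ∈ A, m ≤ Y i ω}

/-- `m(N,E,x) = 1 + max {k ≥ 1 : ∃ ℓ ∈ {1,…,N+1}, T^{ℓ+j} x ∉ E ∀ j = 0,…,k-1}`,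
the longest excursion out of `E` beginning in the first `N` steps. -/
def mExc (T : X → X) (E : Set X) (N : ℕ) (x : X) : ℕ :=
  1 + sSup {k : ℕ | 1 ≤ k ∧ ∃ l : ℕ, 1 ≤ l ∧ l ≤ N + 1 ∧ ∀ j < k, T^[l + j] x ∉ E}

/-- `f : ℕ → ℝ` is slowly varying: `f(⌊dN⌋)/f(N) → 1` for all `d > 0`. -/
def SlowlyVarying (f : ℕ → ℝ) : Prop :=
  ∀ d : ℝ, 0 < d → Tendsto (fun N : ℕ => f ⌊d * (N : ℝ)⌋₊ / f N) atTop (nhds 1)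

/-- `b` is an asymptotic inverse of `a`. -/
def IsAsymptoticInverse (a b : ℝ → ℝ) : Prop :=
  Tendsto (fun y => a (b y) / y) atTop (nhds 1) ∧
  Tendsto (fun y => b (a y) / y) atTop (nhds 1)

/-- `b` is an asymptotic inverse of `a` (sequence version). -/
def IsAsymptoticInverseSeq (a b : ℕ → ℝ) : Prop :=
  Tendsto (fun n : ℕ => a ⌊b n⌋₊ / (n : ℝ)) atTop (nhds 1) ∧
  Tendsto (fun n : ℕ => b ⌊a n⌋₊ / (n : ℝ)) atTop (nhds 1)

/-- The σ-field `F_h^k` generated by the random variables `Y_m`, `m ∈ s`. -/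
def sigmaGen {Ω : Type*} (Y : ℕ → Ω → ℝ) (s : Set ℕ) : MeasurableSpace Ω :=
  ⨆ m ∈ s, MeasurableSpace.comap (Y m) (inferInstance : MeasurableSpace ℝ)

/-- The sequence `(Y_n)` is ψ-mixing with mixing coefficients `ψ`:
`|P(B ∩ C)/(P(B)P(C)) - 1| ≤ ψ(n)` for all `B ∈ F_0^j`, `C ∈ F_{j+n}^∞` of
positive measure. -/
def PsiMixingWith {Ω : Type*} [MeasurableSpace Ω] (P : Measure Ω) (Y : ℕ → Ω → ℝ)
    (ψ : ℕ → ℝ) : Prop :=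
  ∀ n j : ℕ, ∀ B C : Set Ω,
    MeasurableSet[sigmaGen Y (Set.Icc 0 j)] B →
    MeasurableSet[sigmaGen Y (Set.Ici (j + n))] C →
    0 < P B → 0 < P C →
    |(P (B ∩ C)).toReal / ((P B).toReal * (P C).toReal) - 1| ≤ ψ n

/-- `Pt` is the partition `P_E` of `E` induced by `T_E`: a partition of `E`
(mod μ) into measurable sets, each of which is mapped onto `E` by `T_E` a.s.,
and which is the finest such partition. -/
structure IsInducedPartition (T : X → X) (E : Set X) (μ : Measure X)
    (Pt : Set (Set X)) : Prop where
  subset_base : ∀ p ∈ Pt, p ⊆ E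
  measurableSet : ∀ p ∈ Pt, MeasurableSet p
  pairwiseDisjoint : Pt.PairwiseDisjoint id
  cover : μ (E \ ⋃₀ Pt) = 0
  onto : ∀ p ∈ Pt, μ (E \ inducedMap T E '' p) = 0
  finest : ∀ Qt : Set (Set X), (∀ q ∈ Qt, q ⊆ E) → (∀ q ∈ Qt, MeasurableSet q) →
    Qt.PairwiseDisjoint id → μ (E \ ⋃₀ Qt) = 0 →
    (∀ q ∈ Qt, μ (E \ inducedMap T E '' q) = 0) →
    ∀ p ∈ Pt, ∃ q ∈ Qt, μ (p \ q) = 0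

/-- `f` is (piecewise) constant on each element of the partition `Pt`. -/
def ConstantOn (Pt : Set (Set X)) (f : X → ℝ) : Prop :=
  ∀ p ∈ Pt, ∀ x ∈ p, ∀ y ∈ p, f x = f y

/-- `E` induces rapid ψ-mixing (relative to the induced partition `Pt = P_E`):
`T_E(A_n) = E` a.s. for all `n ≥ 1`, and for every sequence `(φ_n)` of functions
piecewise constant on `Pt`, the sequence `(φ_n ∘ T_E^{n-1})` is ψ-mixing with
coefficients `ψ(n)` satisfying `∑ ψ(n)/n < ∞`. -/
def InducesRapidPsiMixing (T : X → X) (E : Set X) (μ : Measure X)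
    (Pt : Set (Set X)) : Prop :=
  (∀ n : ℕ, 1 ≤ n → μ (E \ inducedMap T E '' levelSet T E n) = 0) ∧
  ∀ φ : ℕ → X → ℝ, (∀ n, ConstantOn Pt (φ n)) →
    ∃ ψ : ℕ → ℝ, (∀ n, 0 ≤ ψ n) ∧ Tendsto ψ atTop (nhds 0) ∧
      Summable (fun n : ℕ => ψ n / (n : ℝ)) ∧
      PsiMixingWith (μ.restrict E) (fun n x => φ n ((inducedMap T E)^[n] x)) ψ

/-- The backward continued fraction map `T_BCF(x) = {1/(1-x)}`. -/
def Tbcf (x : ℝ) : ℝ := Int.fract (1 / (1 - x))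

/-- `E = [1/2, 1]` for the backward continued fraction map. -/
def Ebcf : Set ℝ := Set.Icc (1/2 : ℝ) 1

/-- The `T_BCF`-invariant measure with density `1/(x log 2)` on `[0,1]`. -/
def muBCF : Measure ℝ :=
  (volume.restrict (Set.Icc (0:ℝ) 1)).withDensity fun x =>
    ENNReal.ofReal (1 / (x * Real.log 2))

/-- The observable `g(x) = ⌊1/(1-x)⌋ + 1` for the backward continued fractions. -/
def gBCF (x : ℝ) : ℝ := (⌊1 / (1 - x)⌋ : ℝ) + 1

open Classical in
/-- The even-integer continued fraction map: `T_ECF(x) = 1 - {1/x}` on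
`⋃_{k ≥ 1} (1/(2k), 1/(2k-1))` and `T_ECF(x) = {1/x}` otherwise. -/
def Tecf (x : ℝ) : ℝ :=
  if x ∈ ⋃ k : ℕ, Set.Ioo (1 / (2 * (k : ℝ) + 2)) (1 / (2 * (k : ℝ) + 1))
  then 1 - Int.fract (1 / x) else Int.fract (1 / x)

/-- `E = [0, 1/2]` for the even-integer continued fraction map. -/
def Eecf : Set ℝ := Set.Icc (0:ℝ) (1/2)

/-- The `T_ECF`-invariant measure with density `1/((1-x²) log √3)` on `[0,1]`. -/
def muECF : Measure ℝ :=
  (volume.restrict (Set.Icc (0:ℝ) 1)).withDensity fun x =>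
    ENNReal.ofReal (1 / ((1 - x ^ 2) * Real.log (Real.sqrt 3)))

/-- The observable `g(x) = 2⌊1/(2x) + 1/2⌋` for the even-integer continued fractions. -/
def gECF (x : ℝ) : ℝ := 2 * (⌊1 / (2 * x) + 1 / 2⌋ : ℝ)

/-- The observable `g̃(x) = ⌊1/x⌋` for the even-integer continued fractions. -/
def gtECF (x : ℝ) : ℝ := (⌊1 / x⌋ : ℝ)

/-- The tail weights `∑_{j ≥ k} gaussWeight j x` of the Gauss transfer operator. -/
def gaussTail (k : ℕ) (x : ℝ) : ℝ := (1 + x) / (k + 1 + x)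

/-- The weights of the transfer operator of the Gauss map relative to the Gauss measure;
the index `k` belongs to the digit `k + 1`. -/
def gaussWeight (k : ℕ) (x : ℝ) : ℝ := (1 + x) / ((k + 1 + x) * (k + 2 + x))

/-- The inverse branch of the Gauss map belonging to the digit `k + 1`. -/
def gaussBranch (k : ℕ) (x : ℝ) : ℝ := 1 / (k + 1 + x)

/-- The transfer operator of the Gauss map relative to the Gauss measure. -/
def gaussOp (f : ℝ → ℝ) (x : ℝ) : ℝ := ∑' k : ℕ, gaussWeight k x * f (gaussBranch k x)

lemma gaussWeight_nonneg (k : ℕ) {x : ℝ} (hx : 0 ≤ x) : 0 ≤ gaussWeight k x := by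
  unfold gaussWeight; positivity

lemma gaussTail_sub_succ (k : ℕ) {x : ℝ} (hx : 0 ≤ x) :
    gaussTail k x - gaussTail (k + 1) x = gaussWeight k x := by
  unfold gaussWeight gaussTail
  have h1 : (k : ℝ) + 1 + x ≠ 0 := by positivity
  have h2 : (k : ℝ) + 2 + x ≠ 0 := by positivity
  have h3 : (k : ℝ) + 1 + 1 + x ≠ 0 := by positivity
  push_cast
  field_simp
  ring

lemma gaussTail_zero {x : ℝ} (hx : 0 ≤ x) : gaussTail 0 x = 1 := by
  unfold gaussTail
  have : (1 : ℝ) + x ≠ 0 := by positivity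
  simp [this]

lemma sum_gaussWeight (n : ℕ) {x : ℝ} (hx : 0 ≤ x) :
    ∑ k ∈ Finset.range n, gaussWeight k x = 1 - gaussTail n x := by
  rw [← gaussTail_zero hx, ← Finset.sum_range_sub' (fun k => gaussTail k x)]
  exact Finset.sum_congr rfl fun k _ => (gaussTail_sub_succ k hx).symm

lemma tendsto_gaussTail {x : ℝ} : Tendsto (fun n => gaussTail n x) atTop (nhds 0) := by
  unfold gaussTail
  apply Tendsto.div_atTop tendsto_const_nhds
  apply tendsto_atTop_add_const_right
  apply tendsto_atTop_add_const_right
  exact tendsto_natCast_atTop_atTop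

lemma hasSum_gaussWeight {x : ℝ} (hx : 0 ≤ x) : HasSum (fun k => gaussWeight k x) 1 := by
  rw [hasSum_iff_tendsto_nat_of_nonneg fun k => gaussWeight_nonneg k hx]
  simp_rw [sum_gaussWeight _ hx]
  simpa using tendsto_gaussTail.const_sub (1 : ℝ)

lemma gaussBranch_mem (k : ℕ) {x : ℝ} (hx : 0 ≤ x) : gaussBranch k x ∈ Icc (0 : ℝ) 1 := by
  unfold gaussBranch
  refine ⟨by positivity, ?_⟩
  rw [div_le_one (by positivity)]
  have : (0 : ℝ) ≤ k := by positivity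
  linarith

lemma summable_gaussOp {f : ℝ → ℝ} {B : ℝ} (hB : ∀ x ∈ Icc (0 : ℝ) 1, |f x| ≤ B)
    {x : ℝ} (hx : 0 ≤ x) : Summable fun k => gaussWeight k x * f (gaussBranch k x) := by
  refine Summable.of_norm_bounded ((hasSum_gaussWeight hx).summable.mul_right B) fun k => ?_
  rw [Real.norm_eq_abs, abs_mul, abs_of_nonneg (gaussWeight_nonneg k hx)]
  exact mul_le_mul_of_nonneg_left (hB _ (gaussBranch_mem k hx)) (gaussWeight_nonneg k hx)

lemma gaussBranch_sub_abs (k : ℕ) {x y : ℝ} (hx : 0 ≤ x) (hy : 0 ≤ y) :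
    |gaussBranch k x - gaussBranch k y| = |x - y| * (1 / ((k + 1 + x) * (k + 1 + y))) := by
  unfold gaussBranch
  have h1 : (0 : ℝ) < (k : ℝ) + 1 + x := by positivity
  have h2 : (0 : ℝ) < (k : ℝ) + 1 + y := by positivity
  rw [div_sub_div _ _ h1.ne' h2.ne', abs_div, abs_of_pos (mul_pos h1 h2), abs_sub_comm x y,
    mul_one_div]
  congr 2
  ring

lemma gaussTail_sub_abs (k : ℕ) {x y : ℝ} (hx : 0 ≤ x) (hy : 0 ≤ y) :
    |gaussTail k x - gaussTail k y| = |x - y| * (k / ((k + 1 + x) * (k + 1 + y))) := by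
  unfold gaussTail
  have h1 : (0 : ℝ) < (k : ℝ) + 1 + x := by positivity
  have h2 : (0 : ℝ) < (k : ℝ) + 1 + y := by positivity
  rw [div_sub_div _ _ h1.ne' h2.ne', abs_div, abs_of_pos (mul_pos h1 h2), ← mul_div_assoc]
  congr 1
  rw [show (1 + x) * (↑k + 1 + y) - (↑k + 1 + x) * (1 + y) = (x - y) * k by ring, abs_mul,
    Nat.abs_cast]

lemma sum_weight_mul_contraction_le (n : ℕ) {x y : ℝ} (hx : 0 ≤ x) (hx1 : x ≤ 1) (hy : 0 ≤ y) :
    ∑ k ∈ Finset.range (n + 1), gaussWeight k x * (1 / ((k + 1 + x) * (k + 1 + y))) ≤ 2 / 3 := by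
  have key : ∑ k ∈ Finset.range (n + 1), gaussWeight k x * (1 / ((k + 1 + x) * (k + 1 + y))) ≤
      1 / 2 + 1 / 4 * (gaussTail 1 x - gaussTail (n + 1) x) := by
    induction n with
    | zero =>
      simp only [zero_add, Finset.range_one, Finset.sum_singleton, gaussWeight, Nat.cast_zero,
        sub_self, mul_zero, add_zero]
      rw [div_mul_div_comm, div_le_div_iff₀ (by positivity) (by positivity)]
      nlinarith [mul_nonneg hx hy, mul_nonneg hx (mul_nonneg hx hy), mul_nonneg hx hx,
        mul_nonneg (mul_nonneg hx hx) (mul_nonneg hx hy), mul_nonneg (mul_nonneg hx hx) hx]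
    | succ n ih =>
      rw [Finset.sum_range_succ]
      have h := gaussTail_sub_succ (n + 1) hx
      have h2 : (1 : ℝ) / (((n + 1 : ℕ) + 1 + x) * ((n + 1 : ℕ) + 1 + y)) ≤ 1 / 4 := by
        apply one_div_le_one_div_of_le (by norm_num)
        have : (0 : ℝ) ≤ n := by positivity
        push_cast
        nlinarith [mul_nonneg hx hy, mul_nonneg this hx, mul_nonneg this hy, mul_nonneg this this]
      have h3 := mul_le_mul_of_nonneg_left h2 (gaussWeight_nonneg (n + 1) hx)
      linarith
  have h1 : gaussTail 1 x ≤ 2 / 3 := by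
    unfold gaussTail
    rw [div_le_div_iff₀ (by positivity) (by positivity)]
    push_cast
    linarith
  have h2 : 0 ≤ gaussTail (n + 1) x := by unfold gaussTail; positivity
  linarith

lemma sum_tail_mul_contraction_le (n : ℕ) :
    ∑ k ∈ Finset.range n, (1 : ℝ) / ((k + 1) * (k + 2) * (k + 3)) ≤ 1 / 4 := by
  have key : ∑ k ∈ Finset.range n, (1 : ℝ) / ((k + 1) * (k + 2) * (k + 3)) =
      1 / 4 - 1 / (2 * (n + 1) * (n + 2)) := by
    induction n with
    | zero => norm_num
    | succ n ih =>
      rw [Finset.sum_range_succ, ih]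
      push_cast
      field_simp
      ring
  rw [key]
  have : (0 : ℝ) ≤ 1 / (2 * (n + 1) * (n + 2)) := by positivity
  linarith

lemma sum_diff_mul_eq (n : ℕ) (D F : ℕ → ℝ) :
    ∑ k ∈ Finset.range (n + 1), (D k - D (k + 1)) * F k =
      D 0 * F 0 + ∑ k ∈ Finset.range n, D (k + 1) * (F (k + 1) - F k) - D (n + 1) * F n := by
  induction n with
  | zero => simp; ring
  | succ n ih =>
    rw [Finset.sum_range_succ, ih, Finset.sum_range_succ]
    ring

lemma tail_mul_branch_le (k : ℕ) {x y : ℝ} (hx : 0 ≤ x) (hy : 0 ≤ y) :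
    |gaussTail (k + 1) x - gaussTail (k + 1) y| * |gaussBranch (k + 1) y - gaussBranch k y| ≤
      |x - y| * (1 / ((k + 1) * (k + 2) * (k + 3))) := by
  rw [gaussTail_sub_abs _ hx hy, mul_assoc]
  refine mul_le_mul_of_nonneg_left ?_ (abs_nonneg _)
  have h : |gaussBranch (k + 1) y - gaussBranch k y| = 1 / ((k + 1 + y) * (k + 2 + y)) := by
    unfold gaussBranch
    have h1 : (0 : ℝ) < (k : ℝ) + 1 + y := by positivity
    have h2 : (0 : ℝ) < ((k + 1 : ℕ) : ℝ) + 1 + y := by positivity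
    rw [div_sub_div _ _ h2.ne' h1.ne', abs_div, abs_of_pos (mul_pos h2 h1)]
    push_cast
    rw [show (1 : ℝ) * (k + 1 + y) - (k + 1 + 1 + y) * 1 = -1 by ring, abs_neg, abs_one]
    congr 1
    ring
  rw [h, div_mul_div_comm, div_le_div_iff₀ (by push_cast; positivity) (by positivity)]
  have hk : (0 : ℝ) ≤ k := by positivity
  push_cast
  have e1 : ((k : ℝ) + 2) * (k + 2) ≤ (k + 1 + 1 + x) * (k + 1 + 1 + y) := by
    apply mul_le_mul <;> first | positivity | linarith
  have e2 : ((k : ℝ) + 1) * (k + 2) ≤ (k + 1 + y) * (k + 2 + y) := by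
    apply mul_le_mul <;> first | positivity | linarith
  calc ((k : ℝ) + 1) * 1 * ((k + 1) * (k + 2) * (k + 3))
      ≤ (((k : ℝ) + 2) * (k + 2)) * ((k + 1) * (k + 2)) := by
        nlinarith [mul_nonneg hk hk, mul_nonneg hk (mul_nonneg hk hk)]
    _ ≤ _ := by
      rw [one_mul]; gcongr

/-- The Gauss transfer operator contracts Lipschitz constants by the factor `11 / 12`. -/
lemma gaussOp_lipschitz {f : ℝ → ℝ} {B L : ℝ} (hB : ∀ x ∈ Icc (0 : ℝ) 1, |f x| ≤ B)
    (hL : ∀ x ∈ Icc (0 : ℝ) 1, ∀ y ∈ Icc (0 : ℝ) 1, |f x - f y| ≤ L * |x - y|)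
    {x y : ℝ} (hx : x ∈ Icc (0 : ℝ) 1) (hy : y ∈ Icc (0 : ℝ) 1) :
    |gaussOp f x - gaussOp f y| ≤ 11 / 12 * L * |x - y| := by
  obtain ⟨hx0, hx1⟩ := hx
  obtain ⟨hy0, hy1⟩ := hy
  have hL0 : 0 ≤ L := by
    have := hL 0 (by simp) 1 (by simp)
    have h2 := abs_nonneg (f 0 - f 1)
    norm_num at this
    linarith
  have hB0 : 0 ≤ B := (abs_nonneg _).trans (hB 0 (by simp))
  have bound : ∀ n : ℕ,
      |∑ k ∈ Finset.range (n + 1), (gaussWeight k x * f (gaussBranch k x)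
        - gaussWeight k y * f (gaussBranch k y))| ≤
      11 / 12 * L * |x - y| + 2 * (B * (1 / ((n : ℝ) + 1))) := by
    intro n
    have split : ∑ k ∈ Finset.range (n + 1), (gaussWeight k x * f (gaussBranch k x)
        - gaussWeight k y * f (gaussBranch k y)) =
        ∑ k ∈ Finset.range (n + 1), gaussWeight k x * (f (gaussBranch k x) - f (gaussBranch k y))
        + ∑ k ∈ Finset.range (n + 1), ((gaussTail k x - gaussTail k y) -
          (gaussTail (k + 1) x - gaussTail (k + 1) y)) * f (gaussBranch k y) := by
      rw [← Finset.sum_add_distrib]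
      refine Finset.sum_congr rfl fun k _ => ?_
      rw [← gaussTail_sub_succ k hx0, ← gaussTail_sub_succ k hy0]
      ring
    have first : |∑ k ∈ Finset.range (n + 1),
        gaussWeight k x * (f (gaussBranch k x) - f (gaussBranch k y))| ≤ L * |x - y| * (2 / 3) := by
      refine (Finset.abs_sum_le_sum_abs _ _).trans ?_
      refine le_trans ?_ (mul_le_mul_of_nonneg_left
        (sum_weight_mul_contraction_le n hx0 hx1 hy0) (by positivity))
      rw [Finset.mul_sum]
      refine Finset.sum_le_sum fun k _ => ?_
      rw [abs_mul, abs_of_nonneg (gaussWeight_nonneg k hx0)]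
      have := hL _ (gaussBranch_mem k hx0) _ (gaussBranch_mem k hy0)
      rw [gaussBranch_sub_abs k hx0 hy0] at this
      calc _ ≤ gaussWeight k x * _ := mul_le_mul_of_nonneg_left this (gaussWeight_nonneg k hx0)
        _ = _ := by ring
    have second : |∑ k ∈ Finset.range (n + 1), ((gaussTail k x - gaussTail k y) -
          (gaussTail (k + 1) x - gaussTail (k + 1) y)) * f (gaussBranch k y)| ≤
          L * |x - y| * (1 / 4) + 2 * (B * (1 / ((n : ℝ) + 1))) := by
      rw [sum_diff_mul_eq n (fun k => gaussTail k x - gaussTail k y)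
        (fun k => f (gaussBranch k y)), gaussTail_zero hx0, gaussTail_zero hy0, sub_self,
        zero_mul, zero_add]
      refine (abs_sub _ _).trans (add_le_add ?_ ?_)
      · refine (Finset.abs_sum_le_sum_abs _ _).trans ?_
        refine le_trans ?_ (mul_le_mul_of_nonneg_left
          (sum_tail_mul_contraction_le n) (by positivity))
        rw [Finset.mul_sum]
        refine Finset.sum_le_sum fun k _ => ?_
        rw [abs_mul]
        have h1 := hL _ (gaussBranch_mem (k + 1) hy0) _ (gaussBranch_mem k hy0)
        have h2 := tail_mul_branch_le k hx0 hy0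
        calc _ ≤ |gaussTail (k + 1) x - gaussTail (k + 1) y| *
              (L * |gaussBranch (k + 1) y - gaussBranch k y|) :=
              mul_le_mul_of_nonneg_left h1 (abs_nonneg _)
          _ = L * (|gaussTail (k + 1) x - gaussTail (k + 1) y| *
              |gaussBranch (k + 1) y - gaussBranch k y|) := by ring
          _ ≤ L * (|x - y| * (1 / ((k + 1) * (k + 2) * (k + 3)))) :=
              mul_le_mul_of_nonneg_left h2 hL0
          _ = _ := by ring
      · rw [abs_mul]
        have h1 := hB _ (gaussBranch_mem n hy0)
        have h2 : |gaussTail (n + 1) x - gaussTail (n + 1) y| ≤ 2 * (1 / ((n : ℝ) + 1)) := by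
          rw [gaussTail_sub_abs _ hx0 hy0]
          have : |x - y| ≤ 1 := by rw [abs_le]; constructor <;> linarith
          have h3 : ((n + 1 : ℕ) : ℝ) / (((n + 1 : ℕ) + 1 + x) * ((n + 1 : ℕ) + 1 + y)) ≤
              2 * (1 / ((n : ℝ) + 1)) := by
            rw [mul_one_div, div_le_div_iff₀ (by positivity) (by positivity)]
            push_cast
            have hn : (0 : ℝ) ≤ n := by positivity
            nlinarith [mul_nonneg hx0 hy0, mul_nonneg hn hx0, mul_nonneg hn hy0]
          calc _ ≤ 1 * _ := mul_le_mul_of_nonneg_right this (by positivity)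
            _ ≤ _ := by rw [one_mul]; exact h3
        calc _ ≤ 2 * (1 / ((n : ℝ) + 1)) * B := by gcongr
          _ = _ := by ring
    rw [split]
    refine (abs_add_le _ _).trans ?_
    linarith
  have hsum := ((summable_gaussOp hB hx0).hasSum.sub (summable_gaussOp hB hy0).hasSum)
  have htend := ((hsum.tendsto_sum_nat).comp (tendsto_add_atTop_nat 1)).abs
  have hlim : Tendsto (fun n : ℕ => 11 / 12 * L * |x - y| + 2 * (B * (1 / ((n : ℝ) + 1)))) atTop
      (nhds (11 / 12 * L * |x - y| + 2 * (B * 0))) :=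
    ((tendsto_one_div_add_atTop_nhds_zero_nat.const_mul B).const_mul 2).const_add _
  have := le_of_tendsto_of_tendsto' htend hlim bound
  simpa [gaussOp] using this

/-- The Gauss map `G(x) = {1/x}`. -/
def gaussMap (x : ℝ) : ℝ := Int.fract (1 / x)

/-- The first regular continued fraction digit `⌊1/x⌋`. -/
def gaussDigit (x : ℝ) : ℕ := ⌊1 / x⌋₊

/-- The Gauss probability measure on `(0, 1]`. -/
def gaussMeasure : Measure ℝ :=
  (volume.restrict (Ioc (0 : ℝ) 1)).withDensity
    fun x => ENNReal.ofReal (1 / ((1 + x) * Real.log 2))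

/-- The transfer operator of the Gauss map on extended nonnegative functions. -/
def gaussOpE (f : ℝ → ENNReal) (x : ℝ) : ENNReal :=
  ∑' k : ℕ, ENNReal.ofReal (gaussWeight k x) * f (gaussBranch k x)

lemma measurable_gaussMap : Measurable gaussMap := by
  unfold gaussMap
  exact (measurable_const.div measurable_id).fract

lemma measurable_gaussDigit : Measurable gaussDigit := by
  unfold gaussDigit
  exact Nat.measurable_floor.comp (measurable_const.div measurable_id)

lemma measurable_gaussWeight (k : ℕ) : Measurable (gaussWeight k) := by
  unfold gaussWeight; fun_prop

lemma measurable_gaussBranch (k : ℕ) : Measurable (gaussBranch k) := by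
  unfold gaussBranch; fun_prop

lemma measurable_gaussOpE {f : ℝ → ENNReal} (hf : Measurable f) : Measurable (gaussOpE f) := by
  unfold gaussOpE
  exact Measurable.tsum fun k =>
    ((measurable_gaussWeight k).ennreal_ofReal).mul (hf.comp (measurable_gaussBranch k))

lemma gaussDigit_gaussBranch (k : ℕ) {y : ℝ} (hy : y ∈ Ico (0 : ℝ) 1) :
    gaussDigit (gaussBranch k y) = k + 1 := by
  unfold gaussDigit gaussBranch
  rw [one_div_one_div]
  rw [Nat.floor_eq_iff (by have := hy.1; positivity)]
  push_cast
  constructor <;> linarith [hy.1, hy.2]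

lemma gaussMap_gaussBranch (k : ℕ) {y : ℝ} (hy : y ∈ Ico (0 : ℝ) 1) :
    gaussMap (gaussBranch k y) = y := by
  unfold gaussMap gaussBranch
  rw [one_div_one_div, Int.fract_eq_iff]
  exact ⟨hy.1, hy.2, k + 1, by push_cast; ring⟩

lemma image_gaussBranch (k : ℕ) :
    gaussBranch k '' Ico 0 1 = {x | x ∈ Ioc (0 : ℝ) 1 ∧ gaussDigit x = k + 1} := by
  ext x
  constructor
  · rintro ⟨y, hy, rfl⟩
    have h0 := hy.1
    exact ⟨⟨by unfold gaussBranch; positivity, (gaussBranch_mem k hy.1).2⟩,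
      gaussDigit_gaussBranch k hy⟩
  · rintro ⟨⟨h0, h1⟩, hd⟩
    unfold gaussDigit at hd
    rw [Nat.floor_eq_iff (by positivity)] at hd
    push_cast at hd
    refine ⟨1 / x - (k + 1), ⟨by linarith [hd.1], by linarith [hd.2]⟩, ?_⟩
    unfold gaussBranch
    rw [add_sub_cancel, one_div_one_div]

lemma Ioc_eq_iUnion_image : Ioc (0 : ℝ) 1 = ⋃ k, gaussBranch k '' Ico 0 1 := by
  simp_rw [image_gaussBranch]
  ext x
  simp only [mem_iUnion, mem_ofPred_eq]
  constructor
  · intro hx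
    refine ⟨gaussDigit x - 1, hx, ?_⟩
    have : 1 ≤ gaussDigit x := by
      unfold gaussDigit
      rw [Nat.one_le_floor_iff, le_div_iff₀ hx.1]
      linarith [hx.2]
    omega
  · rintro ⟨k, hx, -⟩
    exact hx

lemma measurableSet_image_gaussBranch (k : ℕ) :
    MeasurableSet (gaussBranch k '' Ico 0 1) := by
  rw [image_gaussBranch]
  exact measurableSet_Ioc.inter (measurable_gaussDigit (measurableSet_singleton (k + 1)))

lemma lintegral_gaussMeasure {F : ℝ → ENNReal} (hF : Measurable F) :
    ∫⁻ x, F x ∂gaussMeasure =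
      ∫⁻ x in Ioc (0 : ℝ) 1, ENNReal.ofReal (1 / ((1 + x) * Real.log 2)) * F x := by
  unfold gaussMeasure
  rw [lintegral_withDensity_eq_lintegral_mul _ (by fun_prop) hF]
  rfl

lemma lintegral_image_gaussBranch (k : ℕ) (f h : ℝ → ENNReal) :
    ∫⁻ x in gaussBranch k '' Ico 0 1,
        ENNReal.ofReal (1 / ((1 + x) * Real.log 2)) * (f x * h (gaussMap x)) =
      ∫⁻ y in Ioc (0 : ℝ) 1, ENNReal.ofReal (1 / ((1 + y) * Real.log 2)) *
        (ENNReal.ofReal (gaussWeight k y) * f (gaussBranch k y) * h y) := by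
  have hder : ∀ y ∈ Ico (0 : ℝ) 1,
      HasDerivWithinAt (gaussBranch k) (-1 / (k + 1 + y) ^ 2) (Ico 0 1) y := by
    intro y hy
    have h0 := hy.1
    have hne : (k : ℝ) + 1 + y ≠ 0 := by positivity
    have := ((hasDerivAt_id y).const_add ((k : ℝ) + 1)).inv hne
    unfold gaussBranch
    simp_rw [one_div]
    exact this.hasDerivWithinAt
  have hinj : InjOn (gaussBranch k) (Ico 0 1) := by
    intro x hx y hy hxy
    rw [← gaussMap_gaussBranch k hx, hxy, gaussMap_gaussBranch k hy]
  rw [lintegral_image_eq_lintegral_abs_deriv_mul measurableSet_Ico hder hinj,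
    ← Measure.restrict_congr_set (μ := volume) (Ico_ae_eq_Ioc (a := (0 : ℝ)) (b := 1))]
  refine setLIntegral_congr_fun measurableSet_Ico fun y hy => ?_
  have h0 := hy.1
  have hlog : 0 < Real.log 2 := Real.log_pos (by norm_num)
  rw [gaussMap_gaussBranch k hy]
  have e : ENNReal.ofReal |-1 / ((k : ℝ) + 1 + y) ^ 2| *
      ENNReal.ofReal (1 / ((1 + gaussBranch k y) * Real.log 2)) =
      ENNReal.ofReal (1 / ((1 + y) * Real.log 2)) * ENNReal.ofReal (gaussWeight k y) := by
    rw [← ENNReal.ofReal_mul (abs_nonneg _), ← ENNReal.ofReal_mul (by positivity)]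
    congr 1
    rw [abs_div, abs_neg, abs_one, abs_of_pos (by positivity)]
    unfold gaussBranch gaussWeight
    have h1 : (0 : ℝ) < (k : ℝ) + 1 + y := by positivity
    have h2 : (0 : ℝ) < (k : ℝ) + 2 + y := by positivity
    have h3 : (0 : ℝ) < (k : ℝ) + 1 + y + 1 := by positivity
    field_simp
    ring
  rw [← mul_assoc, e]
  ring

/-- Duality between composition with the Gauss map and the transfer operator. -/
lemma lintegral_mul_comp_gaussMap {f h : ℝ → ENNReal} (hf : Measurable f) (hh : Measurable h) :
    ∫⁻ x, f x * h (gaussMap x) ∂gaussMeasure = ∫⁻ x, gaussOpE f x * h x ∂gaussMeasure := by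
  have hfh : Measurable fun x => f x * h (gaussMap x) := hf.mul (hh.comp measurable_gaussMap)
  have hfh' : Measurable fun x => gaussOpE f x * h x := (measurable_gaussOpE hf).mul hh
  rw [lintegral_gaussMeasure hfh, lintegral_gaussMeasure hfh']
  conv_lhs => rw [Ioc_eq_iUnion_image]
  rw [lintegral_iUnion measurableSet_image_gaussBranch]
  · simp_rw [lintegral_image_gaussBranch]
    rw [← lintegral_tsum]
    · refine lintegral_congr fun y => ?_
      rw [ENNReal.tsum_mul_left, ENNReal.tsum_mul_right]
      rfl
    · intro k
      have h1 := measurable_gaussWeight k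
      have h2 := hf.comp (measurable_gaussBranch k)
      exact (Measurable.mul (by fun_prop)
        ((h1.ennreal_ofReal.mul h2).mul hh)).aemeasurable
  · intro i j hij
    rw [Function.onFun, image_gaussBranch, image_gaussBranch, Set.disjoint_left]
    rintro x ⟨-, hi⟩ ⟨-, hj⟩
    omega

lemma lintegral_mul_comp_gaussMap_iterate {f h : ℝ → ENNReal} (hf : Measurable f)
    (hh : Measurable h) (n : ℕ) :
    ∫⁻ x, f x * h (gaussMap^[n] x) ∂gaussMeasure =
      ∫⁻ x, gaussOpE^[n] f x * h x ∂gaussMeasure := by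
  induction n generalizing f with
  | zero => rfl
  | succ n ih =>
    simp_rw [Function.iterate_succ_apply]
    have := lintegral_mul_comp_gaussMap (h := fun y => h (gaussMap^[n] y)) hf
      (hh.comp (measurable_gaussMap.iterate n))
    rw [← ih (measurable_gaussOpE hf), ← this]

lemma ae_gaussMeasure : ∀ᵐ x ∂gaussMeasure, x ∈ Ico (0 : ℝ) 1 := by
  apply (withDensity_absolutelyContinuous _ _).ae_le
  rw [Measure.restrict_congr_set (μ := volume) (Ico_ae_eq_Ioc (a := (0 : ℝ)) (b := 1)).symm]
  exact ae_restrict_mem measurableSet_Ico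

lemma gaussOpE_one {x : ℝ} (hx : 0 ≤ x) : gaussOpE (fun _ => 1) x = 1 := by
  unfold gaussOpE
  simp_rw [mul_one]
  rw [← ENNReal.ofReal_tsum_of_nonneg (fun k => gaussWeight_nonneg k hx)
    (hasSum_gaussWeight hx).summable, (hasSum_gaussWeight hx).tsum_eq, ENNReal.ofReal_one]

lemma measurePreserving_gaussMap : MeasurePreserving gaussMap gaussMeasure gaussMeasure := by
  refine ⟨measurable_gaussMap, ?_⟩
  refine Measure.ext_of_lintegral _ fun h hh => ?_
  rw [lintegral_map hh measurable_gaussMap]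
  have := lintegral_mul_comp_gaussMap (f := fun _ => 1) measurable_const hh
  simp only [one_mul] at this
  rw [this]
  refine lintegral_congr_ae ?_
  filter_upwards [ae_gaussMeasure] with x hx
  rw [gaussOpE_one hx.1, one_mul]

instance : IsProbabilityMeasure gaussMeasure := by
  constructor
  have hlog : 0 < Real.log 2 := Real.log_pos (by norm_num)
  unfold gaussMeasure
  rw [withDensity_apply _ MeasurableSet.univ, Measure.restrict_univ]
  have hint : IntervalIntegrable (fun x : ℝ => 1 / ((1 + x) * Real.log 2)) volume 0 1 := by
    apply ContinuousOn.intervalIntegrable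
    intro x hx
    rw [uIcc_of_le zero_le_one] at hx
    have : (1 + x) * Real.log 2 ≠ 0 := by have := hx.1; positivity
    apply ContinuousAt.continuousWithinAt
    fun_prop (disch := assumption)
  rw [← ofReal_integral_eq_lintegral_ofReal]
  · rw [← intervalIntegral.integral_of_le zero_le_one]
    have : ∫ x in (0 : ℝ)..1, 1 / ((1 + x) * Real.log 2) = 1 := by
      have hd : ∀ x ∈ uIcc (0 : ℝ) 1,
          HasDerivAt (fun x => Real.log (1 + x) / Real.log 2) (1 / ((1 + x) * Real.log 2)) x := by
        intro x hx
        rw [uIcc_of_le zero_le_one] at hx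
        have hne : 1 + x ≠ 0 := by have := hx.1; positivity
        have := (((hasDerivAt_id x).const_add 1).log hne).div_const (Real.log 2)
        rw [div_div] at this
        exact this
      rw [intervalIntegral.integral_eq_sub_of_hasDerivAt hd hint]
      norm_num [hlog.ne']
    rw [this, ENNReal.ofReal_one]
  · exact (intervalIntegrable_iff_integrableOn_Ioc_of_le zero_le_one).1 hint
  · filter_upwards [ae_restrict_mem measurableSet_Ioc] with x hx
    have := hx.1
    simp only [Pi.zero_apply]
    positivity

/-- The conditional expectation of `f (gaussDigit x)` given `gaussMap x = y`. -/
def digitMean (f : ℕ → ℝ) (y : ℝ) : ℝ := ∑' k : ℕ, gaussWeight k y * f (k + 1)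

lemma summable_digitMean {f : ℕ → ℝ} {B : ℝ} (h0 : ∀ k, 0 ≤ f k) (hB : ∀ k, f k ≤ B)
    {x : ℝ} (hx : 0 ≤ x) : Summable fun k => gaussWeight k x * f (k + 1) :=
  Summable.of_nonneg_of_le (fun k => mul_nonneg (gaussWeight_nonneg k hx) (h0 _))
    (fun k => mul_le_mul_of_nonneg_left (hB _) (gaussWeight_nonneg k hx))
    ((hasSum_gaussWeight hx).summable.mul_right B)

lemma summable_inv_mul_digit {f : ℕ → ℝ} {B : ℝ} (h0 : ∀ k, 0 ≤ f k) (hB : ∀ k, f k ≤ B) :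
    Summable fun k : ℕ => 1 / (((k : ℝ) + 1) * (k + 2)) * f (k + 1) := by
  simpa [gaussWeight] using summable_digitMean h0 hB le_rfl

lemma digitMean_nonneg {f : ℕ → ℝ} (h0 : ∀ k, 0 ≤ f k) {x : ℝ} (hx : 0 ≤ x) :
    0 ≤ digitMean f x :=
  tsum_nonneg fun k => mul_nonneg (gaussWeight_nonneg k hx) (h0 _)

lemma digitMean_le {f : ℕ → ℝ} {B : ℝ} (h0 : ∀ k, 0 ≤ f k) (hB : ∀ k, f k ≤ B)
    {x : ℝ} (hx : 0 ≤ x) : digitMean f x ≤ B := by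
  have h := (summable_digitMean h0 hB hx).tsum_le_tsum
    (fun k => mul_le_mul_of_nonneg_left (hB _) (gaussWeight_nonneg k hx))
    ((hasSum_gaussWeight hx).summable.mul_right B)
  rwa [tsum_mul_right, (hasSum_gaussWeight hx).tsum_eq, one_mul] at h

lemma gaussWeight_sub_abs_le (k : ℕ) {x y : ℝ} (hx : 0 ≤ x) (hy : 0 ≤ y) :
    |gaussWeight k x - gaussWeight k y| ≤ 2 * |x - y| * (1 / (((k : ℝ) + 1) * (k + 2))) := by
  have hk : (0 : ℝ) ≤ k := by positivity
  have hX : (0 : ℝ) < k + 1 + x := by positivity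
  have hY : (0 : ℝ) < k + 1 + y := by positivity
  have hX' : (0 : ℝ) < k + 2 + x := by positivity
  have hY' : (0 : ℝ) < k + 2 + y := by positivity
  have e : gaussWeight k x - gaussWeight k y = (x - y) *
      (k / ((k + 1 + x) * (k + 1 + y)) - (k + 1) / ((k + 2 + x) * (k + 2 + y))) := by
    unfold gaussWeight
    field_simp
    ring
  rw [e, abs_mul, mul_comm 2 |x - y|, mul_assoc]
  refine mul_le_mul_of_nonneg_left ?_ (abs_nonneg _)
  have b1 : (k : ℝ) / ((k + 1 + x) * (k + 1 + y)) ≤ 1 / (k + 1) := by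
    rw [div_le_div_iff₀ (by positivity) (by positivity)]
    nlinarith [mul_nonneg hk hx, mul_nonneg hk hy, mul_nonneg hx hy]
  have up : (k : ℝ) / ((k + 1 + x) * (k + 1 + y)) - (k + 1) / ((k + 2 + x) * (k + 2 + y)) ≤
      2 * (1 / ((k + 1) * (k + 2))) := by
    rw [div_sub_div _ _ (by positivity) (by positivity), mul_one_div,
      div_le_div_iff₀ (by positivity) (by positivity)]
    have n1 : (k : ℝ) * ((k + 2 + x) * (k + 2 + y)) - (k + 1 + x) * (k + 1 + y) * (k + 1) ≤
        2 * ((k + 1 + x) * (k + 2 + y)) := by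
      nlinarith [mul_nonneg hk hx, mul_nonneg hk hy, mul_nonneg hx hy]
    have n2 : ((k : ℝ) + 1) * (k + 2) ≤ (k + 1 + y) * (k + 2 + x) := by
      apply mul_le_mul <;> first | positivity | linarith
    calc _ ≤ 2 * (((k : ℝ) + 1 + x) * (k + 2 + y)) * ((k + 1) * (k + 2)) :=
          mul_le_mul_of_nonneg_right n1 (by positivity)
      _ ≤ 2 * (((k : ℝ) + 1 + x) * (k + 2 + y)) * ((k + 1 + y) * (k + 2 + x)) :=
          mul_le_mul_of_nonneg_left n2 (by positivity)
      _ = _ := by ring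
  have lo : (k + 1 : ℝ) / ((k + 2 + x) * (k + 2 + y)) - k / ((k + 1 + x) * (k + 1 + y)) ≤
      2 * (1 / ((k + 1) * (k + 2))) := by
    rw [div_sub_div _ _ (by positivity) (by positivity), mul_one_div,
      div_le_div_iff₀ (by positivity) (by positivity)]
    have n1 : ((k : ℝ) + 1) * ((k + 1 + x) * (k + 1 + y)) - (k + 2 + x) * (k + 2 + y) * k ≤
        2 * ((k + 1 + x) * (k + 2 + y)) := by
      nlinarith [mul_nonneg hk hx, mul_nonneg hk hy, mul_nonneg hx hy]
    have n2 : ((k : ℝ) + 1) * (k + 2) ≤ (k + 1 + y) * (k + 2 + x) := by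
      apply mul_le_mul <;> first | positivity | linarith
    calc _ ≤ 2 * (((k : ℝ) + 1 + x) * (k + 2 + y)) * ((k + 1) * (k + 2)) :=
          mul_le_mul_of_nonneg_right n1 (by positivity)
      _ ≤ 2 * (((k : ℝ) + 1 + x) * (k + 2 + y)) * ((k + 1 + y) * (k + 2 + x)) :=
          mul_le_mul_of_nonneg_left n2 (by positivity)
      _ = _ := by ring
  rw [abs_le]
  constructor <;> linarith

lemma digitMean_lipschitz {f : ℕ → ℝ} {B : ℝ} (h0 : ∀ k, 0 ≤ f k) (hB : ∀ k, f k ≤ B)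
    {x y : ℝ} (hx : 0 ≤ x) (hy : 0 ≤ y) :
    |digitMean f x - digitMean f y| ≤
      2 * (∑' k : ℕ, 1 / (((k : ℝ) + 1) * (k + 2)) * f (k + 1)) * |x - y| := by
  unfold digitMean
  rw [← (summable_digitMean h0 hB hx).tsum_sub (summable_digitMean h0 hB hy)]
  have hs := (summable_inv_mul_digit h0 hB).hasSum.mul_left (2 * |x - y|)
  rw [mul_right_comm]
  rw [← Real.norm_eq_abs (tsum _)]
  refine tsum_of_norm_bounded hs fun k => ?_
  rw [← sub_mul, Real.norm_eq_abs, abs_mul, abs_of_nonneg (h0 _), ← mul_assoc]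
  exact mul_le_mul_of_nonneg_right (gaussWeight_sub_abs_le k hx hy) (h0 _)

lemma le_digitMean {f : ℕ → ℝ} {B : ℝ} (h0 : ∀ k, 0 ≤ f k) (hB : ∀ k, f k ≤ B)
    {x : ℝ} (hx : x ∈ Icc (0 : ℝ) 1) :
    2 / 3 * ∑' k : ℕ, 1 / (((k : ℝ) + 1) * (k + 2)) * f (k + 1) ≤ digitMean f x := by
  unfold digitMean
  rw [← tsum_mul_left]
  refine ((summable_inv_mul_digit h0 hB).mul_left _).tsum_le_tsum (fun k => ?_)
    (summable_digitMean h0 hB hx.1)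
  rw [← mul_assoc]
  refine mul_le_mul_of_nonneg_right ?_ (h0 _)
  obtain ⟨hx0, hx1⟩ := hx
  have hk : (0 : ℝ) ≤ k := by positivity
  unfold gaussWeight
  rw [div_mul_div_comm, div_le_div_iff₀ (by positivity) (by positivity)]
  nlinarith [mul_nonneg hk hx0, mul_nonneg hk (mul_nonneg hk hx0), mul_nonneg hk hk,
    mul_nonneg (mul_nonneg hk hx0) (sub_nonneg.2 hx1), mul_nonneg hx0 (sub_nonneg.2 hx1),
    mul_nonneg hk (sub_nonneg.2 hx1), mul_nonneg (mul_nonneg hk hk) (sub_nonneg.2 hx1)]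

lemma gaussOp_mem_Icc {f : ℝ → ℝ} {B : ℝ} (hf : ∀ x ∈ Icc (0 : ℝ) 1, f x ∈ Icc 0 B)
    {x : ℝ} (hx : 0 ≤ x) : gaussOp f x ∈ Icc 0 B := by
  constructor
  · exact tsum_nonneg fun k => mul_nonneg (gaussWeight_nonneg k hx) (hf _ (gaussBranch_mem k hx)).1
  · have hs := summable_gaussOp (f := f) (B := B)
      (fun y hy => by rw [abs_of_nonneg (hf y hy).1]; exact (hf y hy).2) hx
    have h := hs.tsum_le_tsum
      (fun k => mul_le_mul_of_nonneg_left (hf _ (gaussBranch_mem k hx)).2 (gaussWeight_nonneg k hx))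
      ((hasSum_gaussWeight hx).summable.mul_right B)
    rwa [tsum_mul_right, (hasSum_gaussWeight hx).tsum_eq, one_mul] at h

lemma gaussOpE_eq_ofReal {g : ℝ → ENNReal} {f : ℝ → ℝ} {B : ℝ}
    (hf : ∀ x ∈ Icc (0 : ℝ) 1, f x ∈ Icc 0 B)
    (hg : ∀ x ∈ Icc (0 : ℝ) 1, g x = ENNReal.ofReal (f x)) {x : ℝ} (hx : 0 ≤ x) :
    gaussOpE g x = ENNReal.ofReal (gaussOp f x) := by
  unfold gaussOpE gaussOp
  rw [ENNReal.ofReal_tsum_of_nonneg]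
  · refine tsum_congr fun k => ?_
    rw [hg _ (gaussBranch_mem k hx), ENNReal.ofReal_mul (gaussWeight_nonneg k hx)]
  · exact fun k => mul_nonneg (gaussWeight_nonneg k hx) (hf _ (gaussBranch_mem k hx)).1
  · exact summable_gaussOp (f := f) (B := B)
      (fun y hy => by rw [abs_of_nonneg (hf y hy).1]; exact (hf y hy).2) hx

lemma gaussOp_iterate {g : ℝ → ENNReal} {f : ℝ → ℝ} {B L : ℝ}
    (hf : ∀ x ∈ Icc (0 : ℝ) 1, f x ∈ Icc 0 B)
    (hg : ∀ x ∈ Icc (0 : ℝ) 1, g x = ENNReal.ofReal (f x))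
    (hL : ∀ x ∈ Icc (0 : ℝ) 1, ∀ y ∈ Icc (0 : ℝ) 1, |f x - f y| ≤ L * |x - y|) (n : ℕ) :
    (∀ x ∈ Icc (0 : ℝ) 1, gaussOp^[n] f x ∈ Icc 0 B) ∧
    (∀ x ∈ Icc (0 : ℝ) 1, gaussOpE^[n] g x = ENNReal.ofReal (gaussOp^[n] f x)) ∧
    (∀ x ∈ Icc (0 : ℝ) 1, ∀ y ∈ Icc (0 : ℝ) 1,
      |gaussOp^[n] f x - gaussOp^[n] f y| ≤ (11 / 12) ^ n * L * |x - y|) := by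
  induction n with
  | zero =>
    simp only [Function.iterate_zero, id, pow_zero, one_mul]
    exact ⟨hf, hg, hL⟩
  | succ n ih =>
    obtain ⟨i1, i2, i3⟩ := ih
    simp_rw [Function.iterate_succ_apply']
    refine ⟨fun x hx => gaussOp_mem_Icc i1 hx.1, fun x hx => gaussOpE_eq_ofReal i1 i2 hx.1, ?_⟩
    intro x hx y hy
    have := gaussOp_lipschitz (B := B)
      (fun z hz => by rw [abs_of_nonneg (i1 z hz).1]; exact (i1 z hz).2) i3 hx hy
    rw [pow_succ']
    linarith

/-- The `n`-th regular continued fraction digit (counted from `0`). -/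
def cfDigit (n : ℕ) (x : ℝ) : ℕ := gaussDigit (gaussMap^[n] x)

lemma measurable_cfDigit (n : ℕ) : Measurable (cfDigit n) :=
  measurable_gaussDigit.comp (measurable_gaussMap.iterate n)

lemma integrable_of_bounded_cfDigit {g : ℝ → ℝ} {B : ℝ} (hg : Measurable g)
    (h0 : ∀ x, 0 ≤ g x) (hB : ∀ x, g x ≤ B) : Integrable g gaussMeasure :=
  Integrable.of_bound hg.aestronglyMeasurable B
    (ae_of_all _ fun x => by rw [Real.norm_eq_abs, abs_of_nonneg (h0 x)]; exact hB x)

lemma integral_cfDigit (f : ℕ → ℝ) (n : ℕ) :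
    ∫ x, f (cfDigit n x) ∂gaussMeasure = ∫ x, f (cfDigit 0 x) ∂gaussMeasure := by
  have hm := measurePreserving_gaussMap.iterate n
  have h1 : Measurable fun x => f (gaussDigit x) :=
    (measurable_from_top (f := f)).comp measurable_gaussDigit
  have := integral_map (μ := gaussMeasure) hm.measurable.aemeasurable
    (f := fun x => f (gaussDigit x)) h1.aestronglyMeasurable
  rw [hm.map_eq] at this
  exact this.symm

/-- The digit process after one application of duality. -/
lemma lintegral_digit_mul {f : ℕ → ℝ} {B : ℝ} (h0 : ∀ k, 0 ≤ f k) (hB : ∀ k, f k ≤ B)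
    {h : ℝ → ENNReal} (hh : Measurable h) (n : ℕ) :
    ∫⁻ x, ENNReal.ofReal (f (gaussDigit x)) * h (gaussMap^[n + 1] x) ∂gaussMeasure =
      ∫⁻ x, ENNReal.ofReal (gaussOp^[n] (digitMean f) x) * h x ∂gaussMeasure := by
  set F : ℝ → ENNReal := fun y => ∑' k : ℕ, ENNReal.ofReal (gaussWeight k y) *
    ENNReal.ofReal (f (k + 1)) with hF
  have hFm : Measurable F := Measurable.tsum fun k =>
    ((measurable_gaussWeight k).ennreal_ofReal).mul measurable_const
  have hFeq : ∀ x ∈ Icc (0 : ℝ) 1, F x = ENNReal.ofReal (digitMean f x) := by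
    intro x hx
    simp only [hF, digitMean]
    rw [ENNReal.ofReal_tsum_of_nonneg
      (fun k => mul_nonneg (gaussWeight_nonneg k hx.1) (h0 _)) (summable_digitMean h0 hB hx.1)]
    exact tsum_congr fun k => (ENNReal.ofReal_mul (gaussWeight_nonneg k hx.1)).symm
  have hfm : Measurable fun x => ENNReal.ofReal (f (gaussDigit x)) :=
    ((measurable_from_top (f := f)).comp measurable_gaussDigit).ennreal_ofReal
  have e1 := lintegral_mul_comp_gaussMap (h := fun y => h (gaussMap^[n] y)) hfm
    (hh.comp (measurable_gaussMap.iterate n))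
  have e2 : ∫⁻ x, gaussOpE (fun x => ENNReal.ofReal (f (gaussDigit x))) x * h (gaussMap^[n] x)
      ∂gaussMeasure = ∫⁻ x, F x * h (gaussMap^[n] x) ∂gaussMeasure := by
    refine lintegral_congr_ae ?_
    filter_upwards [ae_gaussMeasure] with x hx
    congr 1
    simp only [gaussOpE, hF]
    exact tsum_congr fun k => by rw [gaussDigit_gaussBranch k hx]
  have e3 := lintegral_mul_comp_gaussMap_iterate hFm hh n
  have e4 : ∫⁻ x, gaussOpE^[n] F x * h x ∂gaussMeasure =
      ∫⁻ x, ENNReal.ofReal (gaussOp^[n] (digitMean f) x) * h x ∂gaussMeasure := by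
    refine lintegral_congr_ae ?_
    filter_upwards [ae_gaussMeasure] with x hx
    have := (gaussOp_iterate (B := B)
      (fun x hx => ⟨digitMean_nonneg h0 hx.1, digitMean_le h0 hB hx.1⟩) hFeq
      (fun x hx y hy => digitMean_lipschitz h0 hB hx.1 hy.1) n).2.1 x ⟨hx.1, hx.2.le⟩
    rw [this]
  exact e1.trans (e2.trans (e3.trans e4))

lemma lintegral_gaussOp_digitMean {f : ℕ → ℝ} {B : ℝ} (h0 : ∀ k, 0 ≤ f k) (hB : ∀ k, f k ≤ B)
    (n : ℕ) : ∫⁻ x, ENNReal.ofReal (gaussOp^[n] (digitMean f) x) ∂gaussMeasure =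
      ENNReal.ofReal (∫ x, f (cfDigit 0 x) ∂gaussMeasure) := by
  have h := lintegral_digit_mul h0 hB (h := fun _ => 1) measurable_const n
  simp only [mul_one] at h
  rw [← h, ofReal_integral_eq_lintegral_ofReal]
  · rfl
  · exact integrable_of_bounded_cfDigit
      ((measurable_from_top (f := f)).comp (measurable_cfDigit 0)) (fun x => h0 _) (fun x => hB _)
  · exact ae_of_all _ fun x => h0 _

lemma gaussOp_digitMean_le {f : ℕ → ℝ} {B : ℝ} (h0 : ∀ k, 0 ≤ f k) (hB : ∀ k, f k ≤ B)
    (n : ℕ) {x : ℝ} (hx : x ∈ Icc (0 : ℝ) 1) :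
    gaussOp^[n] (digitMean f) x ≤
      (1 + 3 * (11 / 12) ^ n) * ∫ x, f (cfDigit 0 x) ∂gaussMeasure := by
  set m := ∑' k : ℕ, 1 / (((k : ℝ) + 1) * (k + 2)) * f (k + 1)
  have hint0 : 0 ≤ ∫ x, f (cfDigit 0 x) ∂gaussMeasure := integral_nonneg fun x => h0 _
  have hm0 : 0 ≤ m := tsum_nonneg fun k => mul_nonneg (by positivity) (h0 _)
  have ae_Icc : ∀ᵐ z ∂gaussMeasure, z ∈ Icc (0 : ℝ) 1 := by
    filter_upwards [ae_gaussMeasure] with z hz using ⟨hz.1, hz.2.le⟩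
  have hm : 2 / 3 * m ≤ ∫ x, f (cfDigit 0 x) ∂gaussMeasure := by
    rw [← ENNReal.ofReal_le_ofReal_iff hint0, ← lintegral_gaussOp_digitMean h0 hB 0]
    calc ENNReal.ofReal (2 / 3 * m) = ∫⁻ _, ENNReal.ofReal (2 / 3 * m) ∂gaussMeasure := by simp
      _ ≤ _ := lintegral_mono_ae (by
        filter_upwards [ae_Icc] with z hz
        exact ENNReal.ofReal_le_ofReal (le_digitMean h0 hB hz))
  have hit := gaussOp_iterate (B := B)
      (fun x hx => ⟨digitMean_nonneg h0 hx.1, digitMean_le h0 hB hx.1⟩) (fun x hx => rfl)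
      (fun x hx y hy => digitMean_lipschitz h0 hB hx.1 hy.1) n
  have hpow : (0 : ℝ) ≤ (11 / 12) ^ n := by positivity
  have hle : gaussOp^[n] (digitMean f) x ≤
      (∫ x, f (cfDigit 0 x) ∂gaussMeasure) + (11 / 12) ^ n * (2 * m) := by
    rw [← ENNReal.ofReal_le_ofReal_iff (by positivity),
      ENNReal.ofReal_add hint0 (by positivity), ← lintegral_gaussOp_digitMean h0 hB n]
    calc ENNReal.ofReal (gaussOp^[n] (digitMean f) x)
        = ∫⁻ _, ENNReal.ofReal (gaussOp^[n] (digitMean f) x) ∂gaussMeasure := by simp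
      _ ≤ ∫⁻ z, (ENNReal.ofReal (gaussOp^[n] (digitMean f) z) +
            ENNReal.ofReal ((11 / 12) ^ n * (2 * m))) ∂gaussMeasure := by
          refine lintegral_mono_ae ?_
          filter_upwards [ae_Icc] with z hz
          rw [← ENNReal.ofReal_add (hit.1 z hz).1 (by positivity)]
          apply ENNReal.ofReal_le_ofReal
          have h1 := (abs_le.1 (hit.2.2 x hx z hz)).2
          have h2 : |x - z| ≤ 1 := by
            rw [abs_le]; constructor <;> linarith [hx.1, hx.2, hz.1, hz.2]
          have h3 : (11 / 12) ^ n * (2 * m) * |x - z| ≤ (11 / 12) ^ n * (2 * m) * 1 :=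
            mul_le_mul_of_nonneg_left h2 (by positivity)
          linarith
      _ = _ := by rw [lintegral_add_right _ measurable_const]; simp
  nlinarith [mul_le_mul_of_nonneg_left hm hpow]

/-- Exponential decay of correlations between continued fraction digits. -/
lemma integral_cfDigit_mul_le {f h : ℕ → ℝ} {B D : ℝ} (hf0 : ∀ k, 0 ≤ f k) (hfB : ∀ k, f k ≤ B)
    (hh0 : ∀ k, 0 ≤ h k) (hhD : ∀ k, h k ≤ D) (i n : ℕ) :
    ∫ x, f (cfDigit i x) * h (cfDigit (i + n + 1) x) ∂gaussMeasure ≤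
      (1 + 3 * (11 / 12) ^ n) * (∫ x, f (cfDigit 0 x) ∂gaussMeasure) *
        ∫ x, h (cfDigit 0 x) ∂gaussMeasure := by
  have mf : ∀ i, Measurable fun x => f (cfDigit i x) := fun i =>
    (measurable_from_top (f := f)).comp (measurable_cfDigit i)
  have mh : ∀ i, Measurable fun x => h (cfDigit i x) := fun i =>
    (measurable_from_top (f := h)).comp (measurable_cfDigit i)
  have hB0 : 0 ≤ B := (hf0 0).trans (hfB 0)
  have hf_int : 0 ≤ ∫ x, f (cfDigit 0 x) ∂gaussMeasure := integral_nonneg fun x => hf0 _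
  have hh_int : 0 ≤ ∫ x, h (cfDigit 0 x) ∂gaussMeasure := integral_nonneg fun x => hh0 _
  have shift : ∫ x, f (cfDigit i x) * h (cfDigit (i + n + 1) x) ∂gaussMeasure =
      ∫ x, f (cfDigit 0 x) * h (cfDigit (n + 1) x) ∂gaussMeasure := by
    have hm := measurePreserving_gaussMap.iterate i
    have := integral_map (μ := gaussMeasure) hm.measurable.aemeasurable
      (f := fun x => f (cfDigit 0 x) * h (cfDigit (n + 1) x))
      ((mf 0).mul (mh (n + 1))).aestronglyMeasurable
    rw [hm.map_eq] at this
    rw [this]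
    refine integral_congr_ae (ae_of_all _ fun x => ?_)
    simp only [cfDigit]
    rw [← Function.iterate_add_apply, ← Function.iterate_add_apply]
    congr 4 <;> ring
  rw [shift, ← ENNReal.ofReal_le_ofReal_iff (by positivity),
    ofReal_integral_eq_lintegral_ofReal (f := fun x => f (cfDigit 0 x) * h (cfDigit (n + 1) x))
      (integrable_of_bounded_cfDigit ((mf 0).mul (mh (n + 1)))
        (fun x => mul_nonneg (hf0 _) (hh0 _))
        (fun x => mul_le_mul (hfB _) (hhD _) (hh0 _) hB0))
      (ae_of_all _ fun x => mul_nonneg (hf0 _) (hh0 _))]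
  have e := lintegral_digit_mul hf0 hfB (h := fun x => ENNReal.ofReal (h (cfDigit 0 x)))
    (mh 0).ennreal_ofReal n
  calc ∫⁻ x, ENNReal.ofReal (f (cfDigit 0 x) * h (cfDigit (n + 1) x)) ∂gaussMeasure
      = ∫⁻ x, ENNReal.ofReal (f (gaussDigit x)) *
          ENNReal.ofReal (h (cfDigit 0 (gaussMap^[n + 1] x))) ∂gaussMeasure := by
        refine lintegral_congr fun x => ?_
        rw [ENNReal.ofReal_mul (hf0 _)]
        rfl
    _ = _ := e
    _ ≤ ∫⁻ x, ENNReal.ofReal ((1 + 3 * (11 / 12) ^ n) * (∫ x, f (cfDigit 0 x) ∂gaussMeasure)) *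
          ENNReal.ofReal (h (cfDigit 0 x)) ∂gaussMeasure := by
        refine lintegral_mono_ae ?_
        filter_upwards [ae_gaussMeasure] with x hx
        exact mul_le_mul_left (ENNReal.ofReal_le_ofReal
          (gaussOp_digitMean_le hf0 hfB n ⟨hx.1, hx.2.le⟩)) _
    _ = _ := by
        rw [lintegral_const_mul _ (mh 0).ennreal_ofReal,
          ← ofReal_integral_eq_lintegral_ofReal
            (integrable_of_bounded_cfDigit (mh 0) (fun x => hh0 _) (fun x => hhD _))
            (ae_of_all _ fun x => hh0 _), ← ENNReal.ofReal_mul (by positivity)]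

lemma digitMean_tail (k : ℕ) {y : ℝ} (hy : 0 ≤ y) :
    digitMean (fun a => if k + 1 ≤ a then 1 else 0) y = gaussTail k y := by
  unfold digitMean
  have h1 : (fun j : ℕ => gaussWeight j y * (if k + 1 ≤ j + 1 then (1 : ℝ) else 0)) =
      fun j => gaussWeight j y - (if j ∈ Finset.range k then gaussWeight j y else 0) := by
    funext j
    by_cases h : k ≤ j
    · simp [h, not_lt.2 h]
    · simp [h, not_le.1 h]
  have h2 : HasSum (fun j => if j ∈ Finset.range k then gaussWeight j y else 0)
      (∑ j ∈ Finset.range k, if j ∈ Finset.range k then gaussWeight j y else 0) :=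
    hasSum_sum_of_ne_finset_zero fun j hj => if_neg hj
  rw [h1, ((hasSum_gaussWeight hy).sub h2).tsum_eq,
    Finset.sum_congr rfl fun j hj => if_pos hj, sum_gaussWeight k hy]
  ring

lemma integral_digit_tail (k : ℕ) :
    (∫ x, (if k + 1 ≤ cfDigit 0 x then (1 : ℝ) else 0) ∂gaussMeasure) ∈
      Icc (1 / ((k : ℝ) + 1)) (2 / ((k : ℝ) + 1)) := by
  have h := lintegral_gaussOp_digitMean (f := fun a => if k + 1 ≤ a then 1 else 0) (B := 1)
    (fun a => by split_ifs <;> norm_num) (fun a => by split_ifs <;> norm_num) 0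
  simp only [Function.iterate_zero, id] at h
  have hI : 0 ≤ ∫ x, (if k + 1 ≤ cfDigit 0 x then (1 : ℝ) else 0) ∂gaussMeasure :=
    integral_nonneg fun x => by simp only [Pi.zero_apply]; split_ifs <;> norm_num
  have hb : ∀ᵐ x ∂gaussMeasure, digitMean (fun a => if k + 1 ≤ a then 1 else 0) x ∈
      Icc (1 / ((k : ℝ) + 1)) (2 / ((k : ℝ) + 1)) := by
    filter_upwards [ae_gaussMeasure] with x hx
    obtain ⟨hx0, hx1⟩ := hx
    have hk : (0 : ℝ) ≤ k := by positivity
    rw [digitMean_tail k hx0]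
    unfold gaussTail
    constructor
    · rw [div_le_div_iff₀ (by positivity) (by positivity)]
      nlinarith [mul_nonneg hk hx0]
    · rw [div_le_div_iff₀ (by positivity) (by positivity)]
      nlinarith [mul_nonneg hk hx0]
  constructor
  · rw [← ENNReal.ofReal_le_ofReal_iff hI, ← h]
    calc ENNReal.ofReal (1 / ((k : ℝ) + 1)) =
          ∫⁻ _, ENNReal.ofReal (1 / ((k : ℝ) + 1)) ∂gaussMeasure := by simp
      _ ≤ _ := lintegral_mono_ae (hb.mono fun x hx => ENNReal.ofReal_le_ofReal hx.1)
  · rw [← ENNReal.ofReal_le_ofReal_iff (by positivity), ← h]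
    calc _ ≤ ∫⁻ _, ENNReal.ofReal (2 / ((k : ℝ) + 1)) ∂gaussMeasure :=
          lintegral_mono_ae (hb.mono fun x hx => ENNReal.ofReal_le_ofReal hx.2)
      _ = _ := by simp

/-- The mean of a continued fraction digit truncated at `c`. -/
def truncMean (c : ℕ) : ℝ := ∫ x, ((min (cfDigit 0 x) c : ℕ) : ℝ) ∂gaussMeasure

lemma cast_min_eq_sum (a c : ℕ) :
    ((min a c : ℕ) : ℝ) = ∑ k ∈ Finset.range c, if k + 1 ≤ a then (1 : ℝ) else 0 := by
  induction c with
  | zero => simp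
  | succ c ih =>
    rw [Finset.sum_range_succ, ← ih]
    split_ifs with h
    · rw [min_eq_right h, min_eq_right (by omega)]; push_cast; ring
    · rw [min_eq_left (by omega), min_eq_left (by omega), add_zero]

lemma cast_min_sq_eq_sum (a c : ℕ) :
    ((min a c : ℕ) : ℝ) ^ 2 =
      ∑ k ∈ Finset.range c, (2 * (k : ℝ) + 1) * if k + 1 ≤ a then (1 : ℝ) else 0 := by
  induction c with
  | zero => simp
  | succ c ih =>
    rw [Finset.sum_range_succ, ← ih]
    split_ifs with h
    · rw [min_eq_right h, min_eq_right (by omega)]; push_cast; ring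
    · rw [min_eq_left (by omega), min_eq_left (by omega), mul_zero, add_zero]

lemma measurable_comp_cfDigit (f : ℕ → ℝ) (i : ℕ) : Measurable fun x => f (cfDigit i x) :=
  (measurable_from_top (f := f)).comp (measurable_cfDigit i)

lemma integrable_digit_tail (k : ℕ) :
    Integrable (fun x => if k + 1 ≤ cfDigit 0 x then (1 : ℝ) else 0) gaussMeasure :=
  integrable_of_bounded_cfDigit (B := 1)
    (measurable_comp_cfDigit (fun a => if k + 1 ≤ a then (1 : ℝ) else 0) 0)
    (fun x => by split_ifs <;> norm_num) (fun x => by split_ifs <;> norm_num)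

lemma truncMean_eq_sum (c : ℕ) : truncMean c = ∑ k ∈ Finset.range c,
    ∫ x, (if k + 1 ≤ cfDigit 0 x then (1 : ℝ) else 0) ∂gaussMeasure := by
  unfold truncMean
  simp_rw [cast_min_eq_sum]
  exact integral_finsetSum _ fun k _ => integrable_digit_tail k

lemma truncMean_succ (c : ℕ) : truncMean (c + 1) ∈
    Icc (truncMean c + 1 / ((c : ℝ) + 1)) (truncMean c + 2 / ((c : ℝ) + 1)) := by
  rw [truncMean_eq_sum, truncMean_eq_sum, Finset.sum_range_succ]
  have := integral_digit_tail c
  exact ⟨by linarith [this.1], by linarith [this.2]⟩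

lemma truncMean_mono : Monotone truncMean := by
  refine monotone_nat_of_le_succ fun c => ?_
  have h := (truncMean_succ c).1
  have : (0 : ℝ) ≤ 1 / ((c : ℝ) + 1) := by positivity
  linarith

lemma log_le_truncMean (c : ℕ) : Real.log (c + 1) ≤ truncMean c := by
  induction c with
  | zero => simp [truncMean_eq_sum]
  | succ c ih =>
    have h := (truncMean_succ c).1
    have h2 : Real.log ((c : ℝ) + 1 + 1) - Real.log (c + 1) ≤ 1 / ((c : ℝ) + 1) := by
      rw [← Real.log_div (by positivity) (by positivity)]
      refine (Real.log_le_sub_one_of_pos (by positivity)).trans_eq ?_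
      field_simp
      ring
    push_cast
    linarith

lemma truncMean_nonneg (c : ℕ) : 0 ≤ truncMean c :=
  integral_nonneg fun _ => Nat.cast_nonneg _

lemma truncMean_add_le (c d : ℕ) : truncMean (c + d) ≤ truncMean c + d * (2 / ((c : ℝ) + 1)) := by
  induction d with
  | zero => simp
  | succ d ih =>
    have h := (truncMean_succ (c + d)).2
    have h2 : 2 / (((c + d : ℕ) : ℝ) + 1) ≤ 2 / ((c : ℝ) + 1) := by
      push_cast
      gcongr
      linarith [(Nat.cast_nonneg d : (0 : ℝ) ≤ d)]
    rw [← add_assoc]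
    push_cast at *
    linarith

lemma integral_trunc_sq_le (c i : ℕ) :
    ∫ x, ((min (cfDigit i x) c : ℕ) : ℝ) ^ 2 ∂gaussMeasure ≤ 4 * c := by
  rw [integral_cfDigit (fun a => ((min a c : ℕ) : ℝ) ^ 2) i]
  simp_rw [cast_min_sq_eq_sum]
  rw [integral_finsetSum _ fun k _ => (integrable_digit_tail k).const_mul _]
  calc _ ≤ ∑ k ∈ Finset.range c, (4 : ℝ) := by
        refine Finset.sum_le_sum fun k _ => ?_
        rw [integral_const_mul]
        calc _ ≤ (2 * (k : ℝ) + 1) * (2 / ((k : ℝ) + 1)) :=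
              mul_le_mul_of_nonneg_left (integral_digit_tail k).2 (by positivity)
          _ ≤ 4 := by
              rw [← mul_div_assoc, div_le_iff₀ (by positivity)]
              linarith
    _ = 4 * c := by simp [mul_comm]

/-- The truncated sum of every other continued fraction digit, starting with digit `r`. -/
def truncSum (r c K : ℕ) (x : ℝ) : ℝ :=
  ∑ i ∈ Finset.range K, ((min (cfDigit (2 * i + r) x) c : ℕ) : ℝ)

lemma measurable_trunc (c i : ℕ) : Measurable fun x => ((min (cfDigit i x) c : ℕ) : ℝ) :=
  measurable_comp_cfDigit (fun a => ((min a c : ℕ) : ℝ)) i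

lemma measurable_truncSum (r c K : ℕ) : Measurable (truncSum r c K) := by
  unfold truncSum
  exact Finset.measurable_sum _ fun i _ => measurable_trunc c _

lemma truncSum_nonneg (r c K : ℕ) (x : ℝ) : 0 ≤ truncSum r c K x :=
  Finset.sum_nonneg fun _ _ => Nat.cast_nonneg _

lemma truncSum_le (r c K : ℕ) (x : ℝ) : truncSum r c K x ≤ K * c := by
  unfold truncSum
  calc _ ≤ ∑ i ∈ Finset.range K, (c : ℝ) :=
        Finset.sum_le_sum fun i _ => Nat.cast_le.2 (min_le_right _ _)
    _ = _ := by simp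

lemma integrable_trunc (c i : ℕ) :
    Integrable (fun x => ((min (cfDigit i x) c : ℕ) : ℝ)) gaussMeasure :=
  integrable_of_bounded_cfDigit (B := c) (measurable_trunc c i)
    (fun _ => Nat.cast_nonneg _) (fun _ => Nat.cast_le.2 (min_le_right _ _))

lemma integral_truncSum (r c K : ℕ) : ∫ x, truncSum r c K x ∂gaussMeasure = K * truncMean c := by
  unfold truncSum
  rw [integral_finsetSum _ fun i _ => integrable_trunc c _]
  simp_rw [fun i => integral_cfDigit (fun a => ((min a c : ℕ) : ℝ)) (2 * i + r)]
  simp [truncMean]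

lemma integrable_truncSum_sq (r c K : ℕ) :
    Integrable (fun x => truncSum r c K x ^ 2) gaussMeasure :=
  integrable_of_bounded_cfDigit (B := (K * c) ^ 2) ((measurable_truncSum r c K).pow_const 2)
    (fun _ => sq_nonneg _)
    (fun x => pow_le_pow_left₀ (truncSum_nonneg r c K x) (truncSum_le r c K x) 2)

lemma integrable_truncSum (r c K : ℕ) : Integrable (truncSum r c K) gaussMeasure :=
  integrable_of_bounded_cfDigit (B := K * c) (measurable_truncSum r c K)
    (fun x => truncSum_nonneg r c K x) (fun x => truncSum_le r c K x)

lemma integral_trunc_mul_trunc_le (c i n : ℕ) :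
    ∫ x, ((min (cfDigit i x) c : ℕ) : ℝ) * ((min (cfDigit (i + n + 1) x) c : ℕ) : ℝ)
      ∂gaussMeasure ≤ (1 + 3 * (11 / 12) ^ n) * truncMean c ^ 2 := by
  have := integral_cfDigit_mul_le (f := fun a => ((min a c : ℕ) : ℝ))
    (h := fun a => ((min a c : ℕ) : ℝ)) (B := c) (D := c) (fun k => Nat.cast_nonneg _)
    (fun k => Nat.cast_le.2 (min_le_right _ _)) (fun k => Nat.cast_nonneg _)
    (fun k => Nat.cast_le.2 (min_le_right _ _)) i n
  rw [sq, ← mul_assoc]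
  exact this

lemma sum_geom_le (K : ℕ) : ∑ i ∈ Finset.range K, ((11 : ℝ) / 12) ^ (K - 1 - i) ≤ 12 := by
  rw [Finset.sum_range_reflect (fun i => ((11 : ℝ) / 12) ^ i) K]
  have := (summable_geometric_of_lt_one (r := (11 : ℝ) / 12) (by norm_num)
    (by norm_num)).sum_le_tsum
    (Finset.range K) (fun i _ => by positivity)
  rw [tsum_geometric_of_lt_one (by norm_num) (by norm_num)] at this
  norm_num at this
  exact this

lemma integral_truncSum_sq_le (r c K : ℕ) :
    ∫ x, truncSum r c K x ^ 2 ∂gaussMeasure ≤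
      K ^ 2 * truncMean c ^ 2 + K * (4 * c + 72 * truncMean c ^ 2) := by
  induction K with
  | zero => simp [truncSum]
  | succ K ih =>
    have e : ∀ x, truncSum r c (K + 1) x ^ 2 = truncSum r c K x ^ 2 +
        2 * ∑ i ∈ Finset.range K, ((min (cfDigit (2 * i + r) x) c : ℕ) : ℝ) *
          ((min (cfDigit (2 * K + r) x) c : ℕ) : ℝ) +
        ((min (cfDigit (2 * K + r) x) c : ℕ) : ℝ) ^ 2 := by
      intro x
      unfold truncSum
      rw [Finset.sum_range_succ, ← Finset.sum_mul]
      ring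
    have hi : ∀ i j, Integrable (fun x => ((min (cfDigit i x) c : ℕ) : ℝ) *
        ((min (cfDigit j x) c : ℕ) : ℝ)) gaussMeasure := fun i j =>
      integrable_of_bounded_cfDigit (B := (c : ℝ) * c)
        ((measurable_trunc c i).mul (measurable_trunc c j))
        (fun x => by positivity)
        (fun x => mul_le_mul (Nat.cast_le.2 (min_le_right _ _)) (Nat.cast_le.2 (min_le_right _ _))
          (Nat.cast_nonneg _) (Nat.cast_nonneg _))
    have hsum : Integrable (fun x => 2 * ∑ i ∈ Finset.range K,
        ((min (cfDigit (2 * i + r) x) c : ℕ) : ℝ) *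
          ((min (cfDigit (2 * K + r) x) c : ℕ) : ℝ)) gaussMeasure :=
      (integrable_finsetSum _ fun i _ => hi _ _).const_mul 2
    have hsq : Integrable (fun x => ((min (cfDigit (2 * K + r) x) c : ℕ) : ℝ) ^ 2)
        gaussMeasure := by
      simp_rw [sq]
      exact hi _ _
    have hadd : Integrable (fun x => truncSum r c K x ^ 2 + 2 * ∑ i ∈ Finset.range K,
        ((min (cfDigit (2 * i + r) x) c : ℕ) : ℝ) *
          ((min (cfDigit (2 * K + r) x) c : ℕ) : ℝ)) gaussMeasure :=
      (integrable_truncSum_sq r c K).add hsum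
    simp_rw [e]
    rw [integral_add hadd hsq,
      integral_add (integrable_truncSum_sq r c K) hsum, integral_const_mul,
      integral_finsetSum _ fun i _ => hi _ _]
    have hcross : ∑ i ∈ Finset.range K, ∫ x, ((min (cfDigit (2 * i + r) x) c : ℕ) : ℝ) *
        ((min (cfDigit (2 * K + r) x) c : ℕ) : ℝ) ∂gaussMeasure ≤
        K * truncMean c ^ 2 + 36 * truncMean c ^ 2 := by
      calc _ ≤ ∑ i ∈ Finset.range K,
            (1 + 3 * ((11 : ℝ) / 12) ^ (K - 1 - i)) * truncMean c ^ 2 := by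
            refine Finset.sum_le_sum fun i hiK => ?_
            have hiK := Finset.mem_range.1 hiK
            have := integral_trunc_mul_trunc_le c (2 * i + r) (2 * (K - i) - 1)
            rw [show 2 * i + r + (2 * (K - i) - 1) + 1 = 2 * K + r by omega] at this
            refine this.trans (mul_le_mul_of_nonneg_right ?_ (sq_nonneg _))
            have : ((11 : ℝ) / 12) ^ (2 * (K - i) - 1) ≤ (11 / 12) ^ (K - 1 - i) :=
              pow_le_pow_of_le_one (by norm_num) (by norm_num) (by omega)
            linarith
        _ = K * truncMean c ^ 2 + 3 * (∑ i ∈ Finset.range K, ((11 : ℝ) / 12) ^ (K - 1 - i)) *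
              truncMean c ^ 2 := by
            rw [← Finset.sum_mul, Finset.sum_add_distrib, ← Finset.mul_sum]
            simp
            ring
        _ ≤ _ := by nlinarith [sum_geom_le K, sq_nonneg (truncMean c)]
    have hdiag := integral_trunc_sq_le c (2 * K + r)
    rw [Nat.cast_succ]
    nlinarith [sq_nonneg (truncMean c)]

lemma variance_truncSum_le (r c K : ℕ) :
    ∫ x, (truncSum r c K x - K * truncMean c) ^ 2 ∂gaussMeasure ≤
      K * (4 * c + 72 * truncMean c ^ 2) := by
  have e : ∀ x, (truncSum r c K x - K * truncMean c) ^ 2 = truncSum r c K x ^ 2 -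
      2 * (K * truncMean c) * truncSum r c K x + (K * truncMean c) ^ 2 := fun x => by ring
  have hsub : Integrable (fun x => truncSum r c K x ^ 2 -
      2 * (K * truncMean c) * truncSum r c K x) gaussMeasure :=
    (integrable_truncSum_sq r c K).sub ((integrable_truncSum r c K).const_mul _)
  simp_rw [e]
  rw [integral_add hsub (integrable_const _), integral_sub (integrable_truncSum_sq r c K)
    ((integrable_truncSum r c K).const_mul _), integral_const_mul, integral_truncSum]
  have := integral_truncSum_sq_le r c K
  simp only [integral_const, probReal_univ, one_smul]
  nlinarith

lemma measure_two_large_le (c i j : ℕ) (hij : i < j) :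
    gaussMeasure {x | c < cfDigit i x ∧ c < cfDigit j x} ≤
      ENNReal.ofReal (16 / ((c : ℝ) + 1) ^ 2) := by
  obtain ⟨n, rfl⟩ : ∃ n, j = i + n + 1 := ⟨j - i - 1, by omega⟩
  have hm : MeasurableSet {x | c < cfDigit i x ∧ c < cfDigit (i + n + 1) x} :=
    (measurable_cfDigit i (measurableSet_Ioi (a := c))).inter
      (measurable_cfDigit (i + n + 1) (measurableSet_Ioi (a := c)))
  have h := integral_cfDigit_mul_le (f := fun a => if c + 1 ≤ a then 1 else 0)
    (h := fun a => if c + 1 ≤ a then 1 else 0) (B := 1) (D := 1)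
    (fun a => by split_ifs <;> norm_num) (fun a => by split_ifs <;> norm_num)
    (fun a => by split_ifs <;> norm_num) (fun a => by split_ifs <;> norm_num) i n
  have e : ∀ x, (if c + 1 ≤ cfDigit i x then (1 : ℝ) else 0) *
      (if c + 1 ≤ cfDigit (i + n + 1) x then (1 : ℝ) else 0) =
      {x | c < cfDigit i x ∧ c < cfDigit (i + n + 1) x}.indicator (fun _ => (1 : ℝ)) x := by
    intro x
    by_cases h1 : c < cfDigit i x <;> by_cases h2 : c < cfDigit (i + n + 1) x <;>
      simp [h1, h2, Set.indicator]
  simp_rw [e] at h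
  rw [integral_indicator hm, setIntegral_const, smul_eq_mul, mul_one] at h
  rw [← ENNReal.ofReal_toReal (measure_ne_top gaussMeasure _)]
  refine ENNReal.ofReal_le_ofReal (h.trans ?_)
  obtain ⟨t1, t2⟩ := integral_digit_tail c
  have t0 : (0 : ℝ) ≤ 1 / ((c : ℝ) + 1) := by positivity
  set I := ∫ x, (if c + 1 ≤ cfDigit 0 x then (1 : ℝ) else 0) ∂gaussMeasure
  have hpow : ((11 : ℝ) / 12) ^ n ≤ 1 := pow_le_one₀ (by norm_num) (by norm_num)
  calc (1 + 3 * (11 / 12) ^ n) * I * I ≤ 4 * (2 / ((c : ℝ) + 1)) * (2 / ((c : ℝ) + 1)) := by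
        gcongr <;> linarith
    _ = _ := by field_simp; norm_num

/-- The truncation level used for the first `K` digits. -/
def truncLevel (K : ℕ) : ℕ := ⌈(K : ℝ) * Real.log (K + 1) ^ (2 / 3 : ℝ)⌉₊

/-- The centering constant `K ↦ K * E[min(a₁, c_K)]`. -/
def truncNorm (K : ℕ) : ℝ := K * truncMean (truncLevel K)

/-- A subsequence growing slightly slower than exponentially. -/
def subseq (k : ℕ) : ℕ := ⌈Real.exp ((k : ℝ) ^ (7 / 8 : ℝ))⌉₊

lemma one_le_log_succ {K : ℕ} (hK : 2 ≤ K) : 1 ≤ Real.log (K + 1) := by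
  have hK' : (2 : ℝ) ≤ K := by exact_mod_cast hK
  rw [Real.le_log_iff_exp_le (by positivity)]
  have := Real.exp_one_lt_d9
  linarith

lemma truncLevel_mono : Monotone truncLevel := by
  intro K K' h
  have h' : (K : ℝ) ≤ K' := by exact_mod_cast h
  refine Nat.ceil_mono ?_
  have : 0 ≤ Real.log (K + 1) := Real.log_nonneg (by linarith [(Nat.cast_nonneg K : (0:ℝ) ≤ K)])
  gcongr

lemma le_truncLevel (K : ℕ) : (K : ℝ) * Real.log (K + 1) ^ (2 / 3 : ℝ) ≤ truncLevel K :=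
  Nat.le_ceil _

lemma le_truncLevel_self {K : ℕ} (hK : 2 ≤ K) : K ≤ truncLevel K := by
  have h := le_truncLevel K
  have h1 := Real.one_le_rpow (one_le_log_succ hK) (by norm_num : (0 : ℝ) ≤ 2 / 3)
  have : (K : ℝ) ≤ truncLevel K := by nlinarith [(Nat.cast_nonneg K : (0:ℝ) ≤ K)]
  exact_mod_cast this

lemma truncLevel_le {K : ℕ} (hK : 2 ≤ K) :
    (truncLevel K : ℝ) ≤ 2 * (K * Real.log (K + 1) ^ (2 / 3 : ℝ)) := by
  have h1 := Real.one_le_rpow (one_le_log_succ hK) (by norm_num : (0 : ℝ) ≤ 2 / 3)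
  have hK' : (2 : ℝ) ≤ K := by exact_mod_cast hK
  have h2 : 1 ≤ K * Real.log (K + 1) ^ (2 / 3 : ℝ) := by nlinarith
  have := Nat.ceil_lt_add_one (show 0 ≤ K * Real.log (K + 1) ^ (2 / 3 : ℝ) by linarith)
  unfold truncLevel
  linarith

lemma log_le_truncMean_truncLevel {K : ℕ} (hK : 2 ≤ K) :
    Real.log (K + 1) ≤ truncMean (truncLevel K) := by
  refine le_trans (Real.log_le_log (by positivity) ?_) (log_le_truncMean _)
  have : (K : ℝ) ≤ truncLevel K := by exact_mod_cast le_truncLevel_self hK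
  linarith

lemma truncNorm_mono : Monotone truncNorm := by
  intro K K' h
  have h' : (K : ℝ) ≤ K' := by exact_mod_cast h
  exact mul_le_mul h' (truncMean_mono (truncLevel_mono h)) (truncMean_nonneg _) (Nat.cast_nonneg _)

lemma le_truncNorm {K : ℕ} (hK : 2 ≤ K) : K * Real.log (K + 1) ≤ truncNorm K :=
  mul_le_mul_of_nonneg_left (log_le_truncMean_truncLevel hK) (Nat.cast_nonneg _)

lemma truncNorm_pos {K : ℕ} (hK : 2 ≤ K) : 0 < truncNorm K := by
  have h := le_truncNorm hK
  have hK' : (2 : ℝ) ≤ K := by exact_mod_cast hK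
  nlinarith [one_le_log_succ hK]

lemma tendsto_log_succ : Tendsto (fun K : ℕ => Real.log (K + 1)) atTop atTop :=
  Real.tendsto_log_atTop.comp (tendsto_atTop_add_const_right _ _ tendsto_natCast_atTop_atTop)

lemma tendsto_truncNorm : Tendsto truncNorm atTop atTop := by
  refine tendsto_atTop_mono' _ ?_ (tendsto_natCast_atTop_atTop (R := ℝ))
  filter_upwards [eventually_ge_atTop 2] with K hK
  have := le_truncNorm hK
  have := one_le_log_succ hK
  nlinarith [(Nat.cast_nonneg K : (0:ℝ) ≤ K)]

lemma tendsto_truncLevel_div :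
    Tendsto (fun K => (truncLevel K : ℝ) / truncNorm K) atTop (nhds 0) := by
  have h1 : Tendsto (fun K : ℕ => 2 * Real.log (K + 1) ^ (-(1 / 3) : ℝ)) atTop (nhds 0) := by
    have := ((tendsto_rpow_neg_atTop (by norm_num : (0 : ℝ) < 1 / 3)).comp
      tendsto_log_succ).const_mul 2
    simpa using this
  refine squeeze_zero' ?_ ?_ h1
  · filter_upwards [eventually_ge_atTop 2] with K hK
    have := truncNorm_pos hK
    positivity
  · filter_upwards [eventually_ge_atTop 2] with K hK
    have hl := one_le_log_succ hK
    have hK' : (2 : ℝ) ≤ K := by exact_mod_cast hK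
    rw [div_le_iff₀ (truncNorm_pos hK)]
    have e : Real.log (K + 1) ^ (2 / 3 : ℝ) =
        Real.log (K + 1) ^ (-(1 / 3) : ℝ) * Real.log (K + 1) := by
      nth_rewrite 3 [← Real.rpow_one (Real.log (K + 1))]
      rw [← Real.rpow_add (by linarith)]
      norm_num
    calc (truncLevel K : ℝ) ≤ 2 * (K * Real.log (K + 1) ^ (2 / 3 : ℝ)) := truncLevel_le hK
      _ = 2 * Real.log (K + 1) ^ (-(1 / 3) : ℝ) * (K * Real.log (K + 1)) := by rw [e]; ring
      _ ≤ _ := by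
        refine mul_le_mul_of_nonneg_left (le_truncNorm hK) ?_
        have : 0 ≤ Real.log (K + 1) := by linarith
        positivity

lemma subseq_mono : Monotone subseq := by
  intro k k' h
  have h' : (k : ℝ) ≤ k' := by exact_mod_cast h
  refine Nat.ceil_mono ?_
  gcongr

lemma tendsto_exp_rpow : Tendsto (fun k : ℕ => Real.exp ((k : ℝ) ^ (7 / 8 : ℝ))) atTop atTop :=
  Real.tendsto_exp_atTop.comp ((tendsto_rpow_atTop (by norm_num)).comp tendsto_natCast_atTop_atTop)

lemma tendsto_subseq : Tendsto subseq atTop atTop :=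
  tendsto_nat_ceil_atTop.comp tendsto_exp_rpow

lemma rpow_le_log_subseq (k : ℕ) : (k : ℝ) ^ (7 / 8 : ℝ) ≤ Real.log (subseq k + 1) := by
  rw [Real.le_log_iff_exp_le (by positivity)]
  exact (Nat.le_ceil _).trans (le_add_of_nonneg_right zero_le_one)

lemma summable_log_subseq :
    Summable fun k : ℕ => Real.log (subseq k + 1) ^ (-(4 / 3) : ℝ) := by
  rw [← summable_nat_add_iff 1]
  have h := (summable_nat_add_iff 1).2
    (Real.summable_nat_rpow.2 (by norm_num : -(7 / 6 : ℝ) < -1))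
  refine Summable.of_nonneg_of_le (fun k => Real.rpow_nonneg (Real.log_nonneg (by simp)) _)
    (fun k => ?_) h
  have hk : (0 : ℝ) < ((k + 1 : ℕ) : ℝ) := by positivity
  rw [show (-(7 / 6) : ℝ) = 7 / 8 * (-(4 / 3)) by norm_num, Real.rpow_mul hk.le]
  exact Real.rpow_le_rpow_of_nonpos (by positivity) (rpow_le_log_subseq _) (by norm_num)

lemma tendsto_succ_rpow_sub :
    Tendsto (fun k : ℕ => ((k + 1 : ℕ) : ℝ) ^ (7 / 8 : ℝ) - (k : ℝ) ^ (7 / 8 : ℝ))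
      atTop (nhds 0) := by
  have h1 : Tendsto (fun k : ℕ => (k : ℝ) ^ (-(1 / 8) : ℝ)) atTop (nhds 0) :=
    (tendsto_rpow_neg_atTop (by norm_num : (0 : ℝ) < 1 / 8)).comp tendsto_natCast_atTop_atTop
  refine squeeze_zero' (Eventually.of_forall fun k => ?_) ?_ h1
  · have : (k : ℝ) ^ (7 / 8 : ℝ) ≤ ((k + 1 : ℕ) : ℝ) ^ (7 / 8 : ℝ) := by
      gcongr
      exact k.le_succ
    linarith
  · filter_upwards [eventually_ge_atTop 1] with k hk
    have hk' : (0 : ℝ) < k := by exact_mod_cast hk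
    have hb := rpow_one_add_le_one_add_mul_self (s := 1 / (k : ℝ)) (p := 7 / 8)
      (by have : 0 ≤ 1 / (k : ℝ) := by positivity
          linarith) (by norm_num) (by norm_num)
    have e : ((k + 1 : ℕ) : ℝ) ^ (7 / 8 : ℝ) =
        (k : ℝ) ^ (7 / 8 : ℝ) * (1 + 1 / (k : ℝ)) ^ (7 / 8 : ℝ) := by
      rw [← Real.mul_rpow hk'.le (by positivity)]
      congr 1
      push_cast
      field_simp
    have e2 : (k : ℝ) ^ (7 / 8 : ℝ) = (k : ℝ) ^ (-(1 / 8) : ℝ) * k := by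
      nth_rewrite 3 [← Real.rpow_one (k : ℝ)]
      rw [← Real.rpow_add hk']
      norm_num
    have p := Real.rpow_pos_of_pos hk' (-(1 / 8))
    rw [e, e2]
    have : (k : ℝ) ^ (-(1 / 8) : ℝ) * k * (1 + 1 / (k : ℝ)) ^ (7 / 8 : ℝ) ≤
        (k : ℝ) ^ (-(1 / 8) : ℝ) * k * (1 + 7 / 8 * (1 / (k : ℝ))) :=
      mul_le_mul_of_nonneg_left hb (by positivity)
    have e3 : (k : ℝ) ^ (-(1 / 8) : ℝ) * k * (1 + 7 / 8 * (1 / (k : ℝ))) =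
      (k : ℝ) ^ (-(1 / 8) : ℝ) * k + 7 / 8 * (k : ℝ) ^ (-(1 / 8) : ℝ) := by field_simp
    linarith

lemma tendsto_subseq_ratio :
    Tendsto (fun k => (subseq (k + 1) : ℝ) / subseq k) atTop (nhds 1) := by
  have hc : Tendsto (fun k => (subseq k : ℝ) / Real.exp ((k : ℝ) ^ (7 / 8 : ℝ))) atTop (nhds 1) :=
    (tendsto_nat_ceil_div_atTop (R := ℝ)).comp tendsto_exp_rpow
  have he := (Real.continuous_exp.tendsto 0).comp tendsto_succ_rpow_sub
  rw [Real.exp_zero] at he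
  have h := (((tendsto_add_atTop_iff_nat 1).2 hc).div hc one_ne_zero).mul he
  rw [div_one, mul_one] at h
  refine h.congr fun k => ?_
  have h1 := Real.exp_pos ((k : ℝ) ^ (7 / 8 : ℝ))
  have h2 := Real.exp_pos (((k + 1 : ℕ) : ℝ) ^ (7 / 8 : ℝ))
  have h3 : (0 : ℝ) < subseq k := Nat.cast_pos.2 (Nat.ceil_pos.2 h1)
  simp only [Pi.div_apply, Function.comp_apply, Real.exp_sub]
  field_simp

lemma truncLevel_le_of_le_two_mul {K K' : ℕ} (hK : 2 ≤ K) (hK' : 2 ≤ K') (h : K' ≤ 2 * K) :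
    (truncLevel K' : ℝ) ≤ 8 * truncLevel K := by
  have hr : (2 : ℝ) ≤ K := by exact_mod_cast hK
  have hr' : (2 : ℝ) ≤ K' := by exact_mod_cast hK'
  have h' : (K' : ℝ) ≤ 2 * K := by exact_mod_cast h
  have hl := one_le_log_succ hK
  have hl' := one_le_log_succ hK'
  have h1 : Real.log (K' + 1) ≤ 2 * Real.log (K + 1) := by
    have : Real.log (((K : ℝ) + 1) ^ 2) = 2 * Real.log (K + 1) := by
      rw [Real.log_pow]; norm_num
    rw [← this]
    exact Real.log_le_log (by positivity) (by nlinarith)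
  have h2 : Real.log (K' + 1) ^ (2 / 3 : ℝ) ≤ 2 * Real.log (K + 1) ^ (2 / 3 : ℝ) := by
    calc _ ≤ (2 * Real.log (K + 1)) ^ (2 / 3 : ℝ) := by
          refine Real.rpow_le_rpow (by linarith) h1 (by norm_num)
      _ = 2 ^ (2 / 3 : ℝ) * Real.log (K + 1) ^ (2 / 3 : ℝ) :=
          Real.mul_rpow (by norm_num) (by linarith)
      _ ≤ 2 ^ (1 : ℝ) * Real.log (K + 1) ^ (2 / 3 : ℝ) := by
          refine mul_le_mul_of_nonneg_right ?_ (Real.rpow_nonneg (by linarith) _)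
          exact Real.rpow_le_rpow_of_exponent_le (by norm_num) (by norm_num)
      _ = _ := by rw [Real.rpow_one]
  calc (truncLevel K' : ℝ) ≤ 2 * (K' * Real.log (K' + 1) ^ (2 / 3 : ℝ)) := truncLevel_le hK'
    _ ≤ 2 * (2 * K * (2 * Real.log (K + 1) ^ (2 / 3 : ℝ))) := by
        have : 0 ≤ Real.log (K' + 1) ^ (2 / 3 : ℝ) := Real.rpow_nonneg (by linarith) _
        gcongr
    _ ≤ 8 * truncLevel K := by linarith [le_truncLevel K]

lemma eventually_subseq_le : ∀ᶠ k in atTop, subseq (k + 1) ≤ 2 * subseq k := by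
  filter_upwards [tendsto_subseq_ratio.eventually (gt_mem_nhds (by norm_num : (1 : ℝ) < 2)),
    tendsto_subseq.eventually_ge_atTop 1] with k h1 h2
  have h2' : (1 : ℝ) ≤ subseq k := by exact_mod_cast h2
  rw [div_lt_iff₀ (by linarith)] at h1
  exact_mod_cast h1.le

lemma tendsto_truncNorm_ratio :
    Tendsto (fun k => truncNorm (subseq (k + 1)) / truncNorm (subseq k)) atTop (nhds 1) := by
  have hM : Tendsto (fun k => 1 + 16 * (Real.log (subseq k + 1))⁻¹) atTop (nhds 1) := by
    have := ((tendsto_log_succ.comp tendsto_subseq).inv_tendsto_atTop.const_mul 16).const_add 1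
    simpa using this
  have hM' : Tendsto (fun k => truncMean (truncLevel (subseq (k + 1))) /
      truncMean (truncLevel (subseq k))) atTop (nhds 1) := by
    refine tendsto_of_tendsto_of_tendsto_of_le_of_le' tendsto_const_nhds hM ?_ ?_
    · filter_upwards [tendsto_subseq.eventually_ge_atTop 2] with k hk
      have := log_le_truncMean_truncLevel hk
      have := one_le_log_succ hk
      rw [le_div_iff₀ (by linarith), one_mul]
      exact truncMean_mono (truncLevel_mono (subseq_mono k.le_succ))
    · filter_upwards [tendsto_subseq.eventually_ge_atTop 2, eventually_subseq_le] with k hk hk2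
      have h1 := log_le_truncMean_truncLevel hk
      have h2 := one_le_log_succ hk
      have hmono := subseq_mono k.le_succ
      have h3 := truncLevel_le_of_le_two_mul hk (hk.trans hmono) hk2
      have h4 := truncLevel_mono hmono
      obtain ⟨d, hd⟩ := Nat.exists_eq_add_of_le h4
      have h5 := truncMean_add_le (truncLevel (subseq k)) d
      rw [Nat.succ_eq_add_one] at hd
      rw [hd] at h3 ⊢
      push_cast at h3
      have h6 : (d : ℝ) * (2 / ((truncLevel (subseq k) : ℝ) + 1)) ≤ 16 := by
        rw [mul_div_assoc', div_le_iff₀ (by positivity)]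
        nlinarith [(Nat.cast_nonneg (truncLevel (subseq k)) : (0:ℝ) ≤ _)]
      rw [div_le_iff₀ (by linarith)]
      have h7 : 1 ≤ (Real.log (subseq k + 1))⁻¹ * truncMean (truncLevel (subseq k)) := by
        rw [inv_mul_eq_div, le_div_iff₀ (by linarith)]
        linarith
      nlinarith
  have := tendsto_subseq_ratio.mul hM'
  rw [mul_one] at this
  refine this.congr fun k => ?_
  unfold truncNorm
  rw [div_mul_div_comm]

lemma eventually_of_eventually_between {n : ℕ → ℕ} (hn : Tendsto n atTop atTop) {P : ℕ → Prop}
    (h : ∀ᶠ k in atTop, ∀ K, n k ≤ K → K < n (k + 1) → P K) : ∀ᶠ K in atTop, P K := by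
  obtain ⟨k₀, hk₀⟩ := eventually_atTop.1 h
  filter_upwards [eventually_ge_atTop (n k₀)] with K hK
  have hex : ∃ i, K < n (k₀ + i) := by
    obtain ⟨k, hk1, hk2⟩ := ((hn.eventually_gt_atTop K).and (eventually_ge_atTop k₀)).exists
    exact ⟨k - k₀, by rwa [Nat.add_sub_cancel' hk2]⟩
  classical
  have hspec := Nat.find_spec hex
  have hmin := fun m => Nat.find_min hex (m := m)
  generalize Nat.find hex = i at hspec hmin
  obtain _ | i := i
  · rw [Nat.add_zero] at hspec
    omega
  · exact hk₀ (k₀ + i) (by omega) K (not_lt.1 (hmin i (by omega))) hspec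

lemma tendsto_ratio_of_subseq {f D : ℕ → ℝ} {n : ℕ → ℕ} (hf : Monotone f) (hD : Monotone D)
    (hf0 : ∀ K, 0 ≤ f K) (hDpos : ∀ᶠ K in atTop, 0 < D K)
    (hn : Tendsto n atTop atTop)
    (h : Tendsto (fun k => f (n k) / D (n k)) atTop (nhds 1))
    (hr : Tendsto (fun k => D (n (k + 1)) / D (n k)) atTop (nhds 1)) :
    Tendsto (fun K => f K / D K) atTop (nhds 1) := by
  have hpos : ∀ᶠ k in atTop, 0 < D (n k) := hn.eventually hDpos
  have hpos' : ∀ᶠ k in atTop, 0 < D (n (k + 1)) :=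
    ((tendsto_add_atTop_iff_nat 1).2 hn).eventually hDpos
  have hlow : Tendsto (fun k => f (n k) / D (n (k + 1))) atTop (nhds 1) := by
    have := h.div hr one_ne_zero
    rw [div_one] at this
    refine this.congr' ?_
    filter_upwards [hpos, hpos'] with k h1 h2
    simp only [Pi.div_apply]
    field_simp
  have hup : Tendsto (fun k => f (n (k + 1)) / D (n k)) atTop (nhds 1) := by
    have := ((tendsto_add_atTop_iff_nat 1).2 h).mul hr
    rw [mul_one] at this
    refine this.congr' ?_
    filter_upwards [hpos, hpos'] with k h1 h2
    field_simp
  rw [tendsto_order]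
  constructor
  · intro a ha
    refine eventually_of_eventually_between hn ?_
    filter_upwards [hlow.eventually (lt_mem_nhds ha), hpos, hpos'] with k h1 h2 h3 K hK1 hK2
    refine h1.trans_le ?_
    exact div_le_div₀ (hf0 _) (hf hK1) (h2.trans_le (hD hK1)) (hD hK2.le)
  · intro a ha
    refine eventually_of_eventually_between hn ?_
    filter_upwards [hup.eventually (gt_mem_nhds ha), hpos, hpos'] with k h1 h2 h3 K hK1 hK2
    refine lt_of_le_of_lt ?_ h1
    exact div_le_div₀ (hf0 _) (hf hK2.le) h2 (hD hK1)

lemma truncSum_level_mono (r : ℕ) (x : ℝ) : Monotone fun K => truncSum r (truncLevel K) K x := by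
  intro K K' h
  have hc := truncLevel_mono h
  calc truncSum r (truncLevel K) K x
      ≤ ∑ i ∈ Finset.range K, ((min (cfDigit (2 * i + r) x) (truncLevel K') : ℕ) : ℝ) :=
        Finset.sum_le_sum fun i _ => Nat.cast_le.2 (min_le_min_left _ hc)
    _ ≤ truncSum r (truncLevel K') K' x :=
        Finset.sum_le_sum_of_subset_of_nonneg (Finset.range_mono h)
          fun _ _ _ => Nat.cast_nonneg _

lemma inv_le_log_rpow {K : ℕ} (hK : 2 ≤ K) :
    1 / (K : ℝ) ≤ 8 * Real.log (K + 1) ^ (-(4 / 3) : ℝ) := by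
  have hl := one_le_log_succ hK
  have hr : (2 : ℝ) ≤ K := by exact_mod_cast hK
  have h1 : Real.log (K + 1) ≤ 2 * √(K + 1) := by
    have : Real.log (K + 1) = 2 * Real.log √(K + 1) := by
      rw [Real.log_sqrt (by positivity)]; ring
    rw [this]
    have := Real.log_le_self (Real.sqrt_nonneg ((K : ℝ) + 1))
    linarith
  have h2 : Real.log (K + 1) ^ (2 : ℕ) ≤ 8 * K := by
    have := Real.sq_sqrt (show (0 : ℝ) ≤ K + 1 by positivity)
    nlinarith [Real.sqrt_nonneg ((K : ℝ) + 1)]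
  have h3 : Real.log (K + 1) ^ (-2 : ℝ) ≤ Real.log (K + 1) ^ (-(4 / 3) : ℝ) :=
    Real.rpow_le_rpow_of_exponent_le hl (by norm_num)
  have h4 : Real.log (K + 1) ^ (-2 : ℝ) = (Real.log (K + 1) ^ (2 : ℕ))⁻¹ := by
    rw [Real.rpow_neg (by linarith)]
    norm_cast
  rw [h4] at h3
  have h5 : 1 / (K : ℝ) ≤ 8 * (Real.log (K + 1) ^ (2 : ℕ))⁻¹ := by
    rw [← div_eq_mul_inv, div_le_div_iff₀ (by linarith) (by positivity)]
    linarith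
  linarith

lemma integral_truncSum_ratio_le (r : ℕ) {K : ℕ} (hK : 2 ≤ K) :
    ∫ x, (truncSum r (truncLevel K) K x / truncNorm K - 1) ^ 2 ∂gaussMeasure ≤
      584 * Real.log (K + 1) ^ (-(4 / 3) : ℝ) := by
  have hN := truncNorm_pos hK
  have hr : (2 : ℝ) ≤ K := by exact_mod_cast hK
  have hl := one_le_log_succ hK
  have hM := log_le_truncMean_truncLevel hK
  have e : ∀ x, (truncSum r (truncLevel K) K x / truncNorm K - 1) ^ 2 =
      (truncNorm K ^ 2)⁻¹ * (truncSum r (truncLevel K) K x - K * truncMean (truncLevel K)) ^ 2 := by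
    intro x
    change _ = (truncNorm K ^ 2)⁻¹ * (truncSum r (truncLevel K) K x - truncNorm K) ^ 2
    field_simp
  simp_rw [e]
  rw [integral_const_mul]
  have hv := variance_truncSum_le r (truncLevel K) K
  have hc := truncLevel_le hK
  set M := truncMean (truncLevel K)
  set l := Real.log (K + 1)
  have e1 : l ^ (2 / 3 : ℝ) = l ^ (2 : ℕ) * l ^ (-(4 / 3) : ℝ) := by
    rw [← Real.rpow_natCast, ← Real.rpow_add (by linarith)]
    norm_num
  have hMpos : 0 < M := by linarith
  have hlp : 0 ≤ l ^ (-(4 / 3) : ℝ) := Real.rpow_nonneg (by linarith) _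
  have hinv := inv_le_log_rpow hK
  calc (truncNorm K ^ 2)⁻¹ * _ ≤ (truncNorm K ^ 2)⁻¹ * (K * (4 * truncLevel K + 72 * M ^ 2)) :=
        mul_le_mul_of_nonneg_left hv (by positivity)
    _ = 4 * truncLevel K / (K * M ^ 2) + 72 * (1 / K) := by
        change ((K * M) ^ 2)⁻¹ * _ = _
        field_simp
    _ ≤ 8 * l ^ (-(4 / 3) : ℝ) + 72 * (8 * l ^ (-(4 / 3) : ℝ)) := by
        gcongr
        rw [div_le_iff₀ (by positivity)]
        calc 4 * (truncLevel K : ℝ) ≤ 4 * (2 * (K * l ^ (2 / 3 : ℝ))) := by gcongr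
          _ = 8 * l ^ (-(4 / 3) : ℝ) * (K * l ^ 2) := by rw [e1]; ring
          _ ≤ _ := by gcongr
    _ = _ := by ring

lemma ae_tendsto_zero_of_summable {α : Type*} [MeasurableSpace α] {μ : Measure α}
    {f : ℕ → α → ℝ} {a : ℕ → ℝ} (hf : ∀ k, Measurable (f k)) (hf0 : ∀ k x, 0 ≤ f k x)
    (hint : ∀ k, Integrable (f k) μ) (ha : Summable a)
    (h : ∀ᶠ k in atTop, ∫ x, f k x ∂μ ≤ a k) :
    ∀ᵐ x ∂μ, Tendsto (fun k => f k x) atTop (nhds 0) := by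
  obtain ⟨k₀, hk₀⟩ := eventually_atTop.1 h
  have hsum : Summable fun k => ∫ x, f (k + k₀) x ∂μ :=
    Summable.of_nonneg_of_le (fun k => integral_nonneg (hf0 _))
      (fun k => hk₀ (k + k₀) (by omega)) ((summable_nat_add_iff k₀).2 ha)
  have hlin : ∫⁻ x, ∑' k, ENNReal.ofReal (f (k + k₀) x) ∂μ ≠ ⊤ := by
    rw [lintegral_tsum fun k => (hf _).ennreal_ofReal.aemeasurable]
    simp_rw [fun k => (ofReal_integral_eq_lintegral_ofReal (hint (k + k₀))
      (ae_of_all _ (hf0 (k + k₀)))).symm]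
    exact hsum.tsum_ofReal_ne_top
  have hae := ae_lt_top' (AEMeasurable.tsum fun k =>
    (hf (k + k₀)).ennreal_ofReal.aemeasurable) hlin
  filter_upwards [hae] with x hx
  have h1 := ENNReal.tendsto_atTop_zero_of_tsum_ne_top hx.ne
  have h2 := (ENNReal.tendsto_toReal ENNReal.zero_ne_top).comp h1
  rw [ENNReal.toReal_zero] at h2
  refine (tendsto_add_atTop_iff_nat k₀).1 (h2.congr fun k => ?_)
  simp [hf0]

theorem ae_tendsto_truncSum (r : ℕ) : ∀ᵐ x ∂gaussMeasure,
    Tendsto (fun K => truncSum r (truncLevel K) K x / truncNorm K) atTop (nhds 1) := by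
  have h := ae_tendsto_zero_of_summable (μ := gaussMeasure)
    (f := fun k x =>
      (truncSum r (truncLevel (subseq k)) (subseq k) x / truncNorm (subseq k) - 1) ^ 2)
    (a := fun k => 584 * Real.log (subseq k + 1) ^ (-(4 / 3) : ℝ))
    (fun k => (((measurable_truncSum r _ _).div_const _).sub_const 1).pow_const 2)
    (fun k x => sq_nonneg _)
    (fun k => ?_) (summable_log_subseq.mul_left 584)
    ((tendsto_subseq.eventually_ge_atTop 2).mono fun k hk => integral_truncSum_ratio_le r hk)
  · filter_upwards [h] with x hx
    refine tendsto_ratio_of_subseq (truncSum_level_mono r x) truncNorm_mono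
      (fun K => truncSum_nonneg _ _ _ _)
      ((eventually_ge_atTop 2).mono fun K hK => truncNorm_pos hK) tendsto_subseq ?_
      tendsto_truncNorm_ratio
    have h1 := (Real.continuous_sqrt.tendsto 0).comp hx
    rw [Real.sqrt_zero] at h1
    have h2 : Tendsto (fun k => |truncSum r (truncLevel (subseq k)) (subseq k) x /
        truncNorm (subseq k) - 1|) atTop (nhds 0) :=
      h1.congr fun k => Real.sqrt_sq_eq_abs _
    have h3 := ((tendsto_zero_iff_abs_tendsto_zero _).2 h2).add_const 1
    simpa using h3
  · have e : ∀ x, (truncSum r (truncLevel (subseq k)) (subseq k) x / truncNorm (subseq k) - 1) ^ 2 =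
        ((truncNorm (subseq k))⁻¹ ^ 2 * truncSum r (truncLevel (subseq k)) (subseq k) x ^ 2 -
        2 * (truncNorm (subseq k))⁻¹ * truncSum r (truncLevel (subseq k)) (subseq k) x) + 1 := by
      intro x
      rw [div_eq_mul_inv]
      ring
    simp_rw [e]
    exact (((integrable_truncSum_sq r _ _).const_mul _).sub
      ((integrable_truncSum r _ _).const_mul _)).add (integrable_const _)

/-- Two digits among the first `n` exceed the level `c`. -/
def twoLarge (c n : ℕ) : Set ℝ :=
  ⋃ i ∈ Finset.range n, ⋃ j ∈ Finset.range n,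
    {x | i < j ∧ c < cfDigit i x ∧ c < cfDigit j x}

lemma measure_twoLarge_le (c n : ℕ) :
    gaussMeasure (twoLarge c n) ≤ ENNReal.ofReal (n * (n * (16 / ((c : ℝ) + 1) ^ 2))) := by
  have h0 : (0 : ℝ) ≤ 16 / ((c : ℝ) + 1) ^ 2 := by positivity
  calc gaussMeasure (twoLarge c n)
      ≤ ∑ i ∈ Finset.range n, ∑ j ∈ Finset.range n,
        gaussMeasure {x | i < j ∧ c < cfDigit i x ∧ c < cfDigit j x} :=
        (measure_biUnion_finset_le _ _).trans
          (Finset.sum_le_sum fun i _ => measure_biUnion_finset_le _ _)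
    _ ≤ ∑ i ∈ Finset.range n, ∑ j ∈ Finset.range n, ENNReal.ofReal (16 / ((c : ℝ) + 1) ^ 2) := by
        refine Finset.sum_le_sum fun i _ => Finset.sum_le_sum fun j _ => ?_
        by_cases hij : i < j
        · refine (measure_mono fun x hx => hx.2).trans (measure_two_large_le c i j hij)
        · simp [hij]
    _ = _ := by
        simp only [Finset.sum_const, Finset.card_range, nsmul_eq_mul]
        rw [ENNReal.ofReal_mul (by positivity), ENNReal.ofReal_mul (by positivity),
          ENNReal.ofReal_natCast]

theorem ae_eventually_atMostOne_large : ∀ᵐ x ∂gaussMeasure, ∀ᶠ K in atTop, ∀ i j, i < j →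
    j < 2 * K + 2 → truncLevel K < cfDigit i x → cfDigit j x ≤ truncLevel K := by
  have hle : ∀ᶠ k in atTop,
      ((2 * subseq (k + 1) + 2 : ℕ) : ℝ) * ((2 * subseq (k + 1) + 2 : ℕ) *
        (16 / ((truncLevel (subseq k) : ℝ) + 1) ^ 2)) ≤
        1600 * Real.log (subseq k + 1) ^ (-(4 / 3) : ℝ) := by
    filter_upwards [tendsto_subseq.eventually_ge_atTop 2, eventually_subseq_le] with k hk hk2
    have hr : (2 : ℝ) ≤ subseq k := by exact_mod_cast hk
    have hr2 : (subseq (k + 1) : ℝ) ≤ 2 * subseq k := by exact_mod_cast hk2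
    have hl := one_le_log_succ hk
    have hc := le_truncLevel (subseq k)
    set l := Real.log (subseq k + 1)
    set c := (truncLevel (subseq k) : ℝ)
    have hp : 0 < l ^ (2 / 3 : ℝ) := Real.rpow_pos_of_pos (by linarith) _
    have e1 : l ^ (-(4 / 3) : ℝ) = ((l ^ (2 / 3 : ℝ)) ^ 2)⁻¹ := by
      rw [← Real.rpow_natCast, ← Real.rpow_mul (by linarith), ← Real.rpow_neg (by linarith)]
      norm_num
    rw [e1]
    push_cast
    have hA : 2 * (subseq (k + 1) : ℝ) + 2 ≤ 5 * subseq k := by linarith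
    calc (2 * (subseq (k + 1) : ℝ) + 2) * ((2 * (subseq (k + 1) : ℝ) + 2) * (16 / (c + 1) ^ 2))
        ≤ 5 * subseq k * (5 * subseq k * (16 / (subseq k * l ^ (2 / 3 : ℝ)) ^ 2)) := by
          have : subseq k * l ^ (2 / 3 : ℝ) ≤ c + 1 := by linarith
          gcongr
      _ = 400 * ((l ^ (2 / 3 : ℝ)) ^ 2)⁻¹ := by
          field_simp
          norm_num
      _ ≤ _ := by
          gcongr
          norm_num
  obtain ⟨k₀, hk₀⟩ := eventually_atTop.1 hle
  have hsum : ∑' k, gaussMeasure (twoLarge (truncLevel (subseq (k + k₀)))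
      (2 * subseq (k + k₀ + 1) + 2)) ≠ ⊤ := by
    refine ne_top_of_le_ne_top (Summable.tsum_ofReal_ne_top
      ((summable_nat_add_iff k₀).2 (summable_log_subseq.mul_left 1600))) ?_
    refine ENNReal.tsum_le_tsum fun k => (measure_twoLarge_le _ _).trans ?_
    exact ENNReal.ofReal_le_ofReal (hk₀ (k + k₀) (by omega))
  filter_upwards [ae_eventually_notMem hsum] with x hx
  refine eventually_of_eventually_between tendsto_subseq ?_
  obtain ⟨k₁, hk₁⟩ := eventually_atTop.1 hx
  filter_upwards [eventually_ge_atTop (k₁ + k₀)] with k hk K hK1 hK2 i j hij hj hi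
  by_contra! hcon
  refine hk₁ (k - k₀) (by omega) ?_
  rw [Nat.sub_add_cancel (by omega)]
  have hmono := truncLevel_mono hK1
  simp only [twoLarge, Set.mem_iUnion, Finset.mem_range, Set.mem_ofPred_eq]
  exact ⟨i, by omega, j, by omega, hij, by omega, by omega⟩

lemma one_div_one_sub_one_div {t : ℝ} (ht : 1 < t) : 1 / (1 - 1 / t) = 1 / (t - 1) + 1 := by
  have h1 : t - 1 ≠ 0 := by linarith
  have h2 : t ≠ 0 := by linarith
  rw [one_sub_div h2]
  field_simp
  ring

lemma Tbcf_one_div {t : ℝ} (ht : 1 < t) : Tbcf (1 / t) = Int.fract (1 / (t - 1)) := by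
  rw [Tbcf, one_div_one_sub_one_div ht, Int.fract_add_one]

lemma gBCF_one_div {t : ℝ} (ht : 1 < t) : gBCF (1 / t) = ⌊1 / (t - 1)⌋ + 2 := by
  rw [gBCF, one_div_one_sub_one_div ht, Int.floor_add_one]
  push_cast
  ring

lemma one_div_sub_mem_Ico {t : ℝ} (ht : 2 < t) : 1 / (t - 1) ∈ Ico (0 : ℝ) 1 := by
  constructor
  · exact one_div_nonneg.2 (by linarith)
  · rw [div_lt_one (by linarith)]
    linarith

lemma gaussMap_irrational {z : ℝ} (hz : Irrational z) :
    Irrational (gaussMap z) ∧ gaussMap z ∈ Ioo (0 : ℝ) 1 := by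
  have h : Irrational (gaussMap z) := by
    unfold gaussMap Int.fract
    rw [one_div]
    exact hz.inv.sub_intCast _
  exact ⟨h, lt_of_le_of_ne (Int.fract_nonneg _) (by simpa using (h.ne_zero).symm),
    Int.fract_lt_one _⟩

lemma one_div_eq_gaussDigit_add {z : ℝ} (hz : 0 < z) : 1 / z = gaussDigit z + gaussMap z := by
  unfold gaussDigit gaussMap
  rw [natCast_floor_eq_intCast_floor (by positivity), Int.floor_add_fract]

lemma Tbcf_iterate {z : ℝ} (hz : Irrational z) (hz0 : 0 < z) {i : ℕ}
    (hi : i < gaussDigit z) : Tbcf^[i] z = 1 / (1 / z - i) := by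
  obtain ⟨-, hG0, hG1⟩ := gaussMap_irrational hz
  induction i with
  | zero => simp
  | succ i ih =>
    have hi' : (i : ℝ) + 1 + 1 ≤ gaussDigit z := by exact_mod_cast hi
    have e := one_div_eq_gaussDigit_add hz0
    rw [Function.iterate_succ_apply', ih (by omega), Tbcf_one_div (by linarith),
      Int.fract_eq_self.2 (one_div_sub_mem_Ico (by linarith))]
    push_cast
    ring_nf

lemma bcf_short_excursion {z : ℝ} (hz : Irrational z) (hz0 : 0 < z) {i : ℕ}
    (hi : i + 1 < gaussDigit z) : gBCF (Tbcf^[i] z) = 2 ∧ Tbcf^[i] z ∉ Ebcf := by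
  obtain ⟨-, hG0, hG1⟩ := gaussMap_irrational hz
  have hi' : (i : ℝ) + 1 + 1 ≤ gaussDigit z := by exact_mod_cast hi
  have e := one_div_eq_gaussDigit_add hz0
  rw [Tbcf_iterate hz hz0 (by omega)]
  have h2 : 2 < 1 / z - i := by linarith
  constructor
  · rw [gBCF_one_div (by linarith), Int.floor_eq_zero_iff.2 (one_div_sub_mem_Ico h2)]
    simp
  · intro h
    have := h.1
    rw [div_le_div_iff₀ (by norm_num) (by linarith)] at this
    linarith

lemma bcf_return {z : ℝ} (hz : Irrational z) (hz0 : 0 < z) {i : ℕ} (hi : i + 1 = gaussDigit z) :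
    gBCF (Tbcf^[i] z) = gaussDigit (gaussMap z) + 2 ∧ Tbcf^[i] z ∈ Ebcf ∧
      Tbcf^[i + 1] z = gaussMap (gaussMap z) := by
  obtain ⟨-, hG0, hG1⟩ := gaussMap_irrational hz
  have hi' : (i : ℝ) + 1 = gaussDigit z := by exact_mod_cast hi
  have e := one_div_eq_gaussDigit_add hz0
  have e2 : 1 / z - i = 1 + gaussMap z := by linarith
  rw [Function.iterate_succ_apply', Tbcf_iterate hz hz0 (by omega), e2,
    gBCF_one_div (by linarith), Tbcf_one_div (by linarith), add_sub_cancel_left]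
  refine ⟨?_, ⟨?_, ?_⟩, rfl⟩
  · unfold gaussDigit
    rw [natCast_floor_eq_intCast_floor (by positivity)]
  · rw [div_le_div_iff₀ (by norm_num) (by linarith)]
    linarith
  · rw [div_le_one (by linarith)]
    linarith

lemma gaussDigit_pos {z : ℝ} (hz : z ∈ Ioo (0 : ℝ) 1) : 0 < gaussDigit z := by
  refine Nat.floor_pos.2 ?_
  rw [le_div_iff₀ hz.1]
  linarith [hz.2]

lemma gaussMap_iterate_irrational {x : ℝ} (hx : Irrational x) (hx' : x ∈ Ioo (0 : ℝ) 1) (n : ℕ) :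
    Irrational (gaussMap^[n] x) ∧ gaussMap^[n] x ∈ Ioo (0 : ℝ) 1 := by
  induction n with
  | zero => exact ⟨hx, hx'⟩
  | succ n ih =>
    rw [Function.iterate_succ_apply']
    exact gaussMap_irrational ih.1

/-- The start of the `j`-th block of the backward continued fraction expansion. -/
def blockStart (x : ℝ) (j : ℕ) : ℕ := ∑ i ∈ Finset.range j, cfDigit (2 * i) x

lemma blockStart_succ (x : ℝ) (j : ℕ) :
    blockStart x (j + 1) = blockStart x j + cfDigit (2 * j) x :=
  Finset.sum_range_succ _ _

lemma blockStart_mono (x : ℝ) : Monotone (blockStart x) :=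
  monotone_nat_of_le_succ fun j => by rw [blockStart_succ]; omega

lemma cfDigit_pos {x : ℝ} (hx : Irrational x) (hx' : x ∈ Ioo (0 : ℝ) 1) (n : ℕ) : 0 < cfDigit n x :=
  gaussDigit_pos (gaussMap_iterate_irrational hx hx' n).2

lemma blockStart_strictMono {x : ℝ} (hx : Irrational x) (hx' : x ∈ Ioo (0 : ℝ) 1)
    : StrictMono (blockStart x) :=
  strictMono_nat_of_lt_succ fun j => by
    rw [blockStart_succ]
    have := cfDigit_pos hx hx' (2 * j)
    omega

lemma Tbcf_iterate_blockStart {x : ℝ} (hx : Irrational x) (hx' : x ∈ Ioo (0 : ℝ) 1)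
    (j : ℕ) : Tbcf^[blockStart x j] x = gaussMap^[2 * j] x := by
  induction j with
  | zero => rfl
  | succ j ih =>
    obtain ⟨h1, h2⟩ := gaussMap_iterate_irrational hx hx' (2 * j)
    have hp := cfDigit_pos hx hx' (2 * j)
    rw [blockStart_succ, add_comm, Function.iterate_add_apply, ih,
      show 2 * (j + 1) = 2 * j + 1 + 1 by ring, Function.iterate_succ_apply',
      Function.iterate_succ_apply']
    have := (bcf_return (i := cfDigit (2 * j) x - 1) h1 h2.1 (Nat.sub_add_cancel hp)).2.2
    rwa [Nat.sub_add_cancel hp] at this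

lemma bcf_inside_block {x : ℝ} (hx : Irrational x) (hx' : x ∈ Ioo (0 : ℝ) 1)
    {j i : ℕ} (hi : i + 1 < cfDigit (2 * j) x) :
    gBCF (Tbcf^[blockStart x j + i] x) = 2 ∧ Tbcf^[blockStart x j + i] x ∉ Ebcf := by
  obtain ⟨h1, h2⟩ := gaussMap_iterate_irrational hx hx' (2 * j)
  rw [add_comm, Function.iterate_add_apply, Tbcf_iterate_blockStart hx hx']
  exact bcf_short_excursion h1 h2.1 hi

lemma bcf_end_block {x : ℝ} (hx : Irrational x) (hx' : x ∈ Ioo (0 : ℝ) 1)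
    {j i : ℕ} (hi : i + 1 = cfDigit (2 * j) x) :
    gBCF (Tbcf^[blockStart x j + i] x) = cfDigit (2 * j + 1) x + 2 ∧
      Tbcf^[blockStart x j + i] x ∈ Ebcf := by
  obtain ⟨h1, h2⟩ := gaussMap_iterate_irrational hx hx' (2 * j)
  rw [add_comm, Function.iterate_add_apply, Tbcf_iterate_blockStart hx hx']
  have := bcf_return h1 h2.1 hi
  refine ⟨?_, this.2.1⟩
  rw [this.1, cfDigit, Function.iterate_succ_apply']

lemma exists_block {x : ℝ} (hx : Irrational x) (hx' : x ∈ Ioo (0 : ℝ) 1) (n : ℕ) :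
    ∃ j, blockStart x j ≤ n ∧ n < blockStart x (j + 1) := by
  have hs := blockStart_strictMono hx hx'
  have hex : ∃ j, n < blockStart x j := ⟨n + 1, hs.le_apply (x := n + 1)⟩
  classical
  have hspec := Nat.find_spec hex
  have hmin := fun m => Nat.find_min hex (m := m)
  generalize Nat.find hex = i at hspec hmin
  obtain _ | i := i
  · exact absurd hspec (by simp [blockStart])
  · exact ⟨i, not_lt.1 (hmin i i.lt_succ_self), hspec⟩

lemma birkhoffSum_blockStart_add {x : ℝ} (hx : Irrational x) (hx' : x ∈ Ioo (0 : ℝ) 1)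
    {J r : ℕ} (hr : r < cfDigit (2 * J) x) :
    birkhoffSum Tbcf gBCF (blockStart x J + r) x =
      birkhoffSum Tbcf gBCF (blockStart x J) x + 2 * r := by
  unfold birkhoffSum
  rw [Finset.sum_range_add]
  congr 1
  rw [Finset.sum_congr rfl fun i hi =>
    (bcf_inside_block hx hx' (j := J) (i := i) (by have := Finset.mem_range.1 hi; omega)).1]
  simp [mul_comm]

lemma birkhoffSum_blockStart {x : ℝ} (hx : Irrational x) (hx' : x ∈ Ioo (0 : ℝ) 1) (J : ℕ) :
    birkhoffSum Tbcf gBCF (blockStart x J) x =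
      2 * blockStart x J + ∑ j ∈ Finset.range J, (cfDigit (2 * j + 1) x : ℝ) := by
  induction J with
  | zero => simp [blockStart, birkhoffSum]
  | succ J ih =>
    obtain ⟨r, hr⟩ := Nat.exists_eq_add_one_of_ne_zero (cfDigit_pos hx hx' (2 * J)).ne'
    rw [blockStart_succ, hr, ← add_assoc, Finset.sum_range_succ]
    have h := birkhoffSum_blockStart_add hx hx' (J := J) (r := r) (by omega)
    unfold birkhoffSum at h ih ⊢
    rw [Finset.sum_range_succ, h, ih, (bcf_end_block hx hx' hr.symm).1]
    push_cast
    ring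

lemma birkhoffSum_eq {x : ℝ} (hx : Irrational x) (hx' : x ∈ Ioo (0 : ℝ) 1)
    {J n : ℕ} (h1 : blockStart x J ≤ n) (h2 : n < blockStart x (J + 1)) :
    birkhoffSum Tbcf gBCF n x =
      2 * n + ∑ j ∈ Finset.range J, (cfDigit (2 * j + 1) x : ℝ) := by
  obtain ⟨r, rfl⟩ := Nat.exists_eq_add_of_le h1
  rw [blockStart_succ] at h2
  rw [birkhoffSum_blockStart_add hx hx' (by omega), birkhoffSum_blockStart hx hx']
  push_cast
  ring

lemma le_birkhoffMax {x : ℝ} {n i : ℕ} (hi : i < n) :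
    gBCF (Tbcf^[i] x) ≤ birkhoffMax Tbcf gBCF n x :=
  le_csSup ((Set.finite_lt_nat n).image _).bddAbove ⟨i, hi, rfl⟩

lemma le_birkhoffMax_of_lt {x : ℝ} (hx : Irrational x) (hx' : x ∈ Ioo (0 : ℝ) 1)
    {J n j : ℕ} (h1 : blockStart x J ≤ n) (hj : j < J) :
    (cfDigit (2 * j + 1) x : ℝ) + 2 ≤ birkhoffMax Tbcf gBCF n x := by
  obtain ⟨r, hr⟩ := Nat.exists_eq_add_one_of_ne_zero (cfDigit_pos hx hx' (2 * j)).ne'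
  rw [← (bcf_end_block hx hx' hr.symm).1]
  refine le_birkhoffMax ?_
  have := blockStart_mono x (show j + 1 ≤ J from hj)
  rw [blockStart_succ] at this
  omega

lemma birkhoffMax_le {x : ℝ} (hx : Irrational x) (hx' : x ∈ Ioo (0 : ℝ) 1)
    {J n : ℕ} (hn : 0 < n) (h2 : n < blockStart x (J + 1)) :
    birkhoffMax Tbcf gBCF n x ≤ 2 ∨
      ∃ j < J, birkhoffMax Tbcf gBCF n x ≤ cfDigit (2 * j + 1) x + 2 := by
  obtain ⟨i, hi, hV⟩ : birkhoffMax Tbcf gBCF n x ∈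
      (fun i => gBCF (Tbcf^[i] x)) '' {i : ℕ | i < n} :=
    Set.Nonempty.csSup_mem ⟨_, 0, hn, rfl⟩ ((Set.finite_lt_nat n).image _)
  have hi : i < n := hi
  simp only at hV
  rw [← hV]
  obtain ⟨j, hj1, hj2⟩ := exists_block hx hx' i
  obtain ⟨r, rfl⟩ := Nat.exists_eq_add_of_le hj1
  rw [blockStart_succ] at hj2
  by_cases hr : r + 1 = cfDigit (2 * j) x
  · right
    refine ⟨j, ?_, (bcf_end_block hx hx' hr).1.le⟩
    by_contra! hJ
    have := blockStart_mono x (show J + 1 ≤ j + 1 by omega)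
    rw [blockStart_succ x j] at this
    omega
  · exact Or.inl (bcf_inside_block hx hx' (by omega)).1.le

lemma excursion_lt {x : ℝ} (hx : Irrational x) (hx' : x ∈ Ioo (0 : ℝ) 1)
    {l k j : ℕ} (hl1 : blockStart x j ≤ l) (hl2 : l < blockStart x (j + 1))
    (h : ∀ i < k, Tbcf^[l + i] x ∉ Ebcf) : k + 1 ≤ cfDigit (2 * j) x := by
  by_contra! hcon
  obtain ⟨r, hr⟩ := Nat.exists_eq_add_one_of_ne_zero (cfDigit_pos hx hx' (2 * j)).ne'
  rw [blockStart_succ] at hl2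
  refine h (blockStart x j + r - l) (by omega) ?_
  rw [show l + (blockStart x j + r - l) = blockStart x j + r by omega]
  exact (bcf_end_block hx hx' hr.symm).2

lemma bddAbove_excursion {x : ℝ} (hx : Irrational x) (hx' : x ∈ Ioo (0 : ℝ) 1) (N : ℕ) :
    BddAbove {k : ℕ | 1 ≤ k ∧ ∃ l : ℕ, 1 ≤ l ∧ l ≤ N + 1 ∧ ∀ j < k, Tbcf^[l + j] x ∉ Ebcf} := by
  refine ⟨blockStart x (N + 2), fun k hk => ?_⟩
  obtain ⟨-, l, -, hl, h⟩ := hk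
  obtain ⟨j, hj1, hj2⟩ := exists_block hx hx' l
  have h1 := excursion_lt hx hx' hj1 hj2 h
  have h2 : j ≤ blockStart x j := (blockStart_strictMono hx hx').le_apply
  have h3 := blockStart_mono x (show j + 1 ≤ N + 2 by omega)
  rw [blockStart_succ] at h3
  omega

lemma exists_mExc_le {x : ℝ} (hx : Irrational x) (hx' : x ∈ Ioo (0 : ℝ) 1) (N : ℕ) :
    ∃ j, blockStart x j ≤ N + 1 ∧ mExc Tbcf Ebcf N x ≤ cfDigit (2 * j) x := by
  unfold mExc
  rcases Set.eq_empty_or_nonempty {k : ℕ | 1 ≤ k ∧ ∃ l : ℕ, 1 ≤ l ∧ l ≤ N + 1 ∧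
    ∀ j < k, Tbcf^[l + j] x ∉ Ebcf} with h | h
  · rw [h]
    refine ⟨0, by simp [blockStart], ?_⟩
    have := cfDigit_pos hx hx' (2 * 0)
    rw [csSup_empty]
    exact this
  · obtain ⟨-, l, -, hl, hk⟩ := Nat.sSup_mem h (bddAbove_excursion hx hx' N)
    obtain ⟨j, hj1, hj2⟩ := exists_block hx hx' l
    have := excursion_lt hx hx' hj1 hj2 hk
    exact ⟨j, hj1.trans hl, by omega⟩

lemma cfDigit_le_mExc {x : ℝ} (hx : Irrational x) (hx' : x ∈ Ioo (0 : ℝ) 1)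
    {N j : ℕ} (hj : blockStart x j ≤ N + 1) :
    cfDigit (2 * j) x ≤ mExc Tbcf Ebcf N x + 1 := by
  unfold mExc
  by_contra! hcon
  have h : cfDigit (2 * j) x - 2 ∈ {k : ℕ | 1 ≤ k ∧ ∃ l : ℕ, 1 ≤ l ∧ l ≤ N + 1 ∧
      ∀ j < k, Tbcf^[l + j] x ∉ Ebcf} := by
    refine ⟨by omega, ?_⟩
    rcases Nat.eq_zero_or_pos j with rfl | hj0
    · refine ⟨1, le_rfl, by omega, fun i hi => ?_⟩
      have := (bcf_inside_block hx hx' (j := 0) (i := 1 + i) (by omega)).2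
      simpa [blockStart] using this
    · have h2 : j ≤ blockStart x j := (blockStart_strictMono hx hx').le_apply
      exact ⟨blockStart x j, by omega, hj, fun i hi =>
        (bcf_inside_block hx hx' (by omega)).2⟩
  have := le_csSup (bddAbove_excursion hx hx' N) h
  omega

lemma sum_min_eq_sum {b : ℕ → ℕ} {c J : ℕ} (h : ∀ j < J, b j ≤ c) :
    ∑ j ∈ Finset.range J, min (b j) c = ∑ j ∈ Finset.range J, b j :=
  Finset.sum_congr rfl fun j hj => min_eq_left (h j (Finset.mem_range.1 hj))

lemma sum_min_add_eq {b : ℕ → ℕ} {c J j₀ : ℕ} (hj₀ : j₀ < J) (hc : c < b j₀)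
    (h : ∀ j < J, j ≠ j₀ → b j ≤ c) :
    ∑ j ∈ Finset.range J, min (b j) c + b j₀ = ∑ j ∈ Finset.range J, b j + c := by
  rw [← Finset.add_sum_erase _ _ (Finset.mem_range.2 hj₀),
    ← Finset.add_sum_erase _ b (Finset.mem_range.2 hj₀), min_eq_right hc.le,
    Finset.sum_congr rfl fun j hj => min_eq_left
      (h j (Finset.mem_range.1 (Finset.mem_of_mem_erase hj)) (Finset.ne_of_mem_erase hj))]
  ring

lemma time_sub_truncSum {x : ℝ} (hx : Irrational x) (hx' : x ∈ Ioo (0 : ℝ) 1)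
    {N J c : ℕ} (h1 : blockStart x J ≤ N + mExc Tbcf Ebcf N x)
    (h2 : N + mExc Tbcf Ebcf N x < blockStart x (J + 1))
    (hone : ∀ i j, i < j → j < 2 * J + 2 → c < cfDigit i x → cfDigit j x ≤ c) :
    N ≤ (∑ j ∈ Finset.range J, min (cfDigit (2 * j) x) c) + c + 1 ∧
      (∑ j ∈ Finset.range J, min (cfDigit (2 * j) x) c) ≤ N + c + 1 := by
  obtain ⟨j₁, hj1, hm1⟩ := exists_mExc_le hx hx' N
  have hj1J : j₁ ≤ J := by
    by_contra! hcon
    have := blockStart_mono x (show J + 1 ≤ j₁ from hcon)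
    have : 1 ≤ mExc Tbcf Ebcf N x := Nat.le_add_right _ _
    omega
  have hothers : ∀ j₀ ≤ J, c < cfDigit (2 * j₀) x → ∀ j ≤ J, j ≠ j₀ → cfDigit (2 * j) x ≤ c := by
    intro j₀ hj₀ hc j hj hne
    rcases lt_or_gt_of_ne hne with h | h
    · by_contra! hcon
      have := hone (2 * j) (2 * j₀) (by omega) (by omega) hcon
      omega
    · exact hone (2 * j₀) (2 * j) (by omega) (by omega) hc
  have hlow := fun j => cfDigit_le_mExc hx hx' (N := N) (j := j)
  rw [blockStart_succ] at h2
  have hs : blockStart x J = ∑ i ∈ Finset.range J, cfDigit (2 * i) x := rfl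
  by_cases hA : ∀ j ≤ J, cfDigit (2 * j) x ≤ c
  · rw [sum_min_eq_sum fun j hj => hA j hj.le, ← hs]
    have := hA J le_rfl
    have := hA j₁ hj1J
    omega
  push Not at hA
  obtain ⟨j₀, hj₀, hc⟩ := hA
  have hoth := hothers j₀ hj₀ hc
  have hm0 : j₁ = j₀ ∨ mExc Tbcf Ebcf N x ≤ c := by
    by_cases h : j₁ = j₀
    · exact Or.inl h
    · exact Or.inr (hm1.trans (hoth j₁ hj1J h))
  rcases lt_or_eq_of_le hj₀ with hlt | rfl
  · have hsum := sum_min_add_eq (b := fun j => cfDigit (2 * j) x) hlt hc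
      fun j hj hne => hoth j hj.le hne
    simp only [← hs] at hsum
    have hJ := hoth J le_rfl hlt.ne'
    have hle := blockStart_mono x (show j₀ + 1 ≤ J from hlt)
    rw [blockStart_succ] at hle
    have := hlow j₀
    rcases hm0 with rfl | hm0 <;> omega
  · rw [sum_min_eq_sum fun j hj => hoth j hj.le hj.ne, ← hs]
    have := hlow j₀
    rcases hm0 with rfl | hm0 <;> omega

lemma sum_sub_trim {x : ℝ} (hx : Irrational x) (hx' : x ∈ Ioo (0 : ℝ) 1)
    {N J c : ℕ} (h1 : blockStart x J ≤ N + mExc Tbcf Ebcf N x)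
    (h2 : N + mExc Tbcf Ebcf N x < blockStart x (J + 1))
    (hone : ∀ i j, i < j → j < 2 * J + 2 → c < cfDigit i x → cfDigit j x ≤ c) :
    |∑ j ∈ Finset.range J, (cfDigit (2 * j + 1) x : ℝ) -
      (max (2 * (mExc Tbcf Ebcf N x : ℝ))
        (birkhoffMax Tbcf gBCF (N + mExc Tbcf Ebcf N x) x) - 2 * mExc Tbcf Ebcf N x) -
      ((∑ j ∈ Finset.range J, min (cfDigit (2 * j + 1) x) c : ℕ) : ℝ)| ≤ c + 2 := by
  have hmpos : 1 ≤ mExc Tbcf Ebcf N x := Nat.le_add_right _ _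
  have hVle := birkhoffMax_le hx hx' (by omega) h2
  have hVge := fun j => le_birkhoffMax_of_lt hx hx' (j := j) h1
  have hc0 : (0 : ℝ) ≤ c := Nat.cast_nonneg c
  set m := mExc Tbcf Ebcf N x with hm
  set V := birkhoffMax Tbcf gBCF (N + m) x
  have hmr : (1 : ℝ) ≤ m := by exact_mod_cast hmpos
  by_cases hA : ∀ j < J, cfDigit (2 * j + 1) x ≤ c
  · rw [sum_min_eq_sum hA]
    have hV : V ≤ c + 2 := by
      rcases hVle with h | ⟨j, hj, h⟩
      · linarith
      · have : (cfDigit (2 * j + 1) x : ℝ) ≤ c := by exact_mod_cast hA j hj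
        linarith
    push_cast
    rcases max_cases (2 * (m : ℝ)) V with ⟨h, -⟩ | ⟨h, h'⟩ <;> rw [h, abs_le] <;>
      constructor <;> linarith
  · push Not at hA
    obtain ⟨j₀, hj₀, hc⟩ := hA
    have hoth : ∀ j < J, j ≠ j₀ → cfDigit (2 * j + 1) x ≤ c := by
      intro j hj hne
      rcases lt_or_gt_of_ne hne with h | h
      · by_contra! hcon
        have := hone (2 * j + 1) (2 * j₀ + 1) (by omega) (by omega) hcon
        omega
      · exact hone (2 * j₀ + 1) (2 * j + 1) (by omega) (by omega) hc
    have hmc : m ≤ c := by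
      obtain ⟨j₁, hj1, hm1⟩ := exists_mExc_le hx hx' N
      have hj1J : j₁ ≤ J := by
        by_contra! hcon
        have := blockStart_mono x (show J + 1 ≤ j₁ from hcon)
        omega
      refine hm1.trans ?_
      rcases lt_or_ge (2 * j₁) (2 * j₀ + 1) with h | h
      · by_contra! hcon
        have := hone (2 * j₁) (2 * j₀ + 1) h (by omega) hcon
        omega
      · exact hone (2 * j₀ + 1) (2 * j₁) (by omega) (by omega) hc
    have hsum := sum_min_add_eq (b := fun j => cfDigit (2 * j + 1) x) hj₀ hc hoth
    have hcr : (c : ℝ) < cfDigit (2 * j₀ + 1) x := by exact_mod_cast hc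
    have hV1 := hVge j₀ hj₀
    have hV2 : V ≤ cfDigit (2 * j₀ + 1) x + 2 := by
      rcases hVle with h | ⟨j, hj, h⟩
      · linarith
      · by_cases hj' : j = j₀
        · rwa [← hj']
        · have : (cfDigit (2 * j + 1) x : ℝ) ≤ c := by exact_mod_cast hoth j hj hj'
          linarith
    have hsum' : ((∑ j ∈ Finset.range J, min (cfDigit (2 * j + 1) x) c : ℕ) : ℝ) +
        cfDigit (2 * j₀ + 1) x = ∑ j ∈ Finset.range J, (cfDigit (2 * j + 1) x : ℝ) + c := by
      exact_mod_cast hsum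
    have hmr' : (m : ℝ) ≤ c := by exact_mod_cast hmc
    rcases max_cases (2 * (m : ℝ)) V with ⟨h, h'⟩ | ⟨h, h'⟩ <;> rw [h, abs_le] <;>
      constructor <;> linarith

lemma tendsto_bcf_digit_sums {x : ℝ} (hx : Irrational x) (hx' : x ∈ Ioo (0 : ℝ) 1)
    (hB : Tendsto (fun K => truncSum 0 (truncLevel K) K x / truncNorm K) atTop (nhds 1))
    (hE : Tendsto (fun K => truncSum 1 (truncLevel K) K x / truncNorm K) atTop (nhds 1))
    (hone : ∀ᶠ K in atTop, ∀ i j, i < j → j < 2 * K + 2 → truncLevel K < cfDigit i x →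
      cfDigit j x ≤ truncLevel K) :
    Tendsto (fun N : ℕ =>
        (birkhoffSum Tbcf gBCF (N + mExc Tbcf Ebcf N x) x
          - max (2 * (mExc Tbcf Ebcf N x : ℝ))
              (birkhoffMax Tbcf gBCF (N + mExc Tbcf Ebcf N x) x)) / (N : ℝ))
        atTop (nhds 3) := by
  choose J hJ1 hJ2 using fun N => exists_block hx hx' (N + mExc Tbcf Ebcf N x)
  have hJ : Tendsto J atTop atTop := by
    refine tendsto_atTop.2 fun k => ?_
    filter_upwards [eventually_ge_atTop (blockStart x k)] with N hN
    by_contra! hcon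
    have := blockStart_mono x (show J N + 1 ≤ k from hcon)
    have := hJ2 N
    omega
  have hc0 : Tendsto (fun N => ((truncLevel (J N) : ℝ) + 2) / truncNorm (J N)) atTop (nhds 0) := by
    have h := (tendsto_truncLevel_div.comp hJ).add
      ((tendsto_const_nhds (x := (2 : ℝ))).div_atTop (tendsto_truncNorm.comp hJ))
    rw [add_zero] at h
    exact h.congr fun N => (add_div _ _ _).symm
  have hclose : ∀ (f : ℕ → ℝ) (r : ℕ),
      Tendsto (fun K => truncSum r (truncLevel K) K x / truncNorm K) atTop (nhds 1) →
      (∀ᶠ N in atTop, |f N - truncSum r (truncLevel (J N)) (J N) x| ≤ truncLevel (J N) + 2) →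
      Tendsto (fun N => f N / truncNorm (J N)) atTop (nhds 1) := by
    intro f r hr hf
    have h0 : Tendsto (fun N => (f N - truncSum r (truncLevel (J N)) (J N) x) / truncNorm (J N))
        atTop (nhds 0) := by
      refine squeeze_zero_norm' ?_ hc0
      filter_upwards [hf, hJ.eventually_ge_atTop 2] with N h1 h2
      have := truncNorm_pos h2
      rw [Real.norm_eq_abs, abs_div, abs_of_pos this]
      gcongr
    have := h0.add (hr.comp hJ)
    rw [zero_add] at this
    refine this.congr fun N => ?_
    simp only [Function.comp_apply]
    ring
  have hN : Tendsto (fun N : ℕ => (N : ℝ) / truncNorm (J N)) atTop (nhds 1) := by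
    refine hclose _ 0 hB ?_
    filter_upwards [hJ.eventually hone] with N h
    obtain ⟨h1, h2⟩ := time_sub_truncSum hx hx' (hJ1 N) (hJ2 N) h
    have e : truncSum 0 (truncLevel (J N)) (J N) x =
        ((∑ j ∈ Finset.range (J N), min (cfDigit (2 * j) x) (truncLevel (J N)) : ℕ) : ℝ) := by
      unfold truncSum
      rw [Nat.cast_sum]
      rfl
    have h1' : (N : ℝ) ≤ truncSum 0 (truncLevel (J N)) (J N) x + truncLevel (J N) + 1 := by
      rw [e]; exact_mod_cast h1
    have h2' : truncSum 0 (truncLevel (J N)) (J N) x ≤ (N : ℝ) + truncLevel (J N) + 1 := by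
      rw [e]; exact_mod_cast h2
    rw [abs_le]
    constructor <;> linarith
  have hX := hclose (fun N => ∑ j ∈ Finset.range (J N), (cfDigit (2 * j + 1) x : ℝ) -
      (max (2 * (mExc Tbcf Ebcf N x : ℝ))
        (birkhoffMax Tbcf gBCF (N + mExc Tbcf Ebcf N x) x) - 2 * mExc Tbcf Ebcf N x)) 1 hE (by
    filter_upwards [hJ.eventually hone] with N h
    have := sum_sub_trim hx hx' (hJ1 N) (hJ2 N) h
    rw [Nat.cast_sum] at this
    exact this)
  have hlim := (hX.div hN one_ne_zero).const_add 2
  rw [div_one, show (2 : ℝ) + 1 = 3 by norm_num] at hlim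
  refine hlim.congr' ?_
  filter_upwards [eventually_gt_atTop 0, hJ.eventually_ge_atTop 2] with N hN0 h2
  have h3 := truncNorm_pos h2
  have hN0' : (0 : ℝ) < N := by exact_mod_cast hN0
  rw [birkhoffSum_eq hx hx' (hJ1 N) (hJ2 N)]
  simp only [Pi.div_apply]
  push_cast
  field_simp
  ring

lemma ae_restrict_of_ae_gaussMeasure {p : ℝ → Prop} (h : ∀ᵐ x ∂gaussMeasure, p x) :
    ∀ᵐ x ∂(volume.restrict (Icc (0 : ℝ) 1)), p x := by
  rw [Measure.restrict_congr_set Ioc_ae_eq_Icc.symm]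
  have hac : volume.restrict (Ioc (0 : ℝ) 1) ≪ gaussMeasure := by
    refine withDensity_absolutelyContinuous' (by fun_prop) ?_
    filter_upwards [ae_restrict_mem measurableSet_Ioc] with x hx
    have := Real.log_pos one_lt_two
    have h0 := hx.1
    rw [Ne, ENNReal.ofReal_eq_zero, not_le]
    positivity
  exact hac.ae_le h

lemma ae_irrational : ∀ᵐ x : ℝ, Irrational x :=
  (countable_range ((↑) : ℚ → ℝ)).ae_notMem volume

/-- Corollary 3.10 (cor:BCF): almost sure behaviour of the sums of the digits
`d_j(x) = g(T_BCF^{j-1} x)` of the backward continued fraction expansion. -/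
theorem bcf_digit_sums :
    ∀ᵐ x ∂(volume.restrict (Set.Icc (0:ℝ) 1)),
      Tendsto (fun N : ℕ =>
        (birkhoffSum Tbcf gBCF (N + mExc Tbcf Ebcf N x) x
          - max (2 * (mExc Tbcf Ebcf N x : ℝ))
              (birkhoffMax Tbcf gBCF (N + mExc Tbcf Ebcf N x) x)) / (N : ℝ))
        atTop (nhds 3) := by
  filter_upwards [ae_restrict_mem measurableSet_Icc, ae_restrict_of_ae ae_irrational,
    ae_restrict_of_ae_gaussMeasure (ae_tendsto_truncSum 0),
    ae_restrict_of_ae_gaussMeasure (ae_tendsto_truncSum 1),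
    ae_restrict_of_ae_gaussMeasure ae_eventually_atMostOne_large] with x hx hirr hB hE hone
  exact tendsto_bcf_digit_sums hirr
    ⟨lt_of_le_of_ne hx.1 hirr.ne_zero.symm, lt_of_le_of_ne hx.2 hirr.ne_one⟩ hB hE hone

end InfErg

end
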